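/- Uniqueness of the classical solution to the free boundary problem: fix K ≥ 0, v ∈ ℝ, T > 0 and a probability measure π₀ on ℝ supported in [0, ∞). For i = 1, 2, suppose y_i ∈ C²([0,T], ℝ) with y_i(0) = 0 and y_i′(0) = v, and p_i : {(t,x) : 0 < t ≤ T, x ≥ y_i(t)} → ℝ is continuous, C¹ in t and C² in x for x > y_i(t), p_i(t,·) is a probability density supported on [y_i(t), ∞) for each t ∈ (0,T], and the pair (p_i, y_i) satisfies: ∂_t p_i(t,x) = (1/2) ∂²_{xx} p_i(t,x) for x > y_i(t); the one-sided spatial derivative ∂⁺_x p_i(t, y_i(t)) = −2 y_i′(t) p_i(t, y_i(t)); y_i″(t) = −(K/2) p_i(t, y_i(t)); and the measures p_i(t,x) dx converge weakly to π₀ as t ↓ 0. Then y₁(t) = y₂(t) for all t ∈ [0,T] and p₁ = p₂ on their common domain. -/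

import Mathlib

open Set MeasureTheory Filter

/-- `(p, y)` is a classical solution of the free boundary problem with impulse constant
`K`, initial velocity `v`, time horizon `T` and initial heat distribution `π₀`.
Here `y', y''` are the first and second derivatives of the barrier `y`, and
`pt, px, pxx` are the partial derivatives `∂_t p`, `∂_x p`, `∂²_{xx} p` of the density
`p` on the domain `{(t,x) : 0 < t ≤ T, x ≥ y(t)}` (one-sided in `x` at the boundary). -/
structure IsFBPSol (K v T : ℝ) (π₀ : Measure ℝ)
    (p pt px pxx : ℝ → ℝ → ℝ) (y y' y'' : ℝ → ℝ) : Prop where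
  /-- `y` is differentiable on `[0,T]` with derivative `y'`. -/
  y_deriv : ∀ t ∈ Set.Icc 0 T, HasDerivWithinAt y (y' t) (Set.Icc 0 T) t
  /-- `y'` is differentiable on `[0,T]` with derivative `y''`. -/
  y'_deriv : ∀ t ∈ Set.Icc 0 T, HasDerivWithinAt y' (y'' t) (Set.Icc 0 T) t
  /-- `y''` is continuous, so `y ∈ C²([0,T])`. -/
  y''_cont : ContinuousOn y'' (Set.Icc 0 T)
  y_init : y 0 = 0
  y'_init : y' 0 = v
  /-- `p` is continuous on the domain `{(t,x) : 0 < t ≤ T, x ≥ y(t)}`. -/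
  p_cont : ContinuousOn (fun q : ℝ × ℝ => p q.1 q.2)
    {q : ℝ × ℝ | q.1 ∈ Set.Ioc 0 T ∧ y q.1 ≤ q.2}
  /-- `p` is differentiable in time, with derivative `pt`, for `x > y(t)`. -/
  p_t : ∀ t ∈ Set.Ioc 0 T, ∀ x, y t < x →
    HasDerivWithinAt (fun s => p s x) (pt t x) (Set.Ioc 0 T) t
  /-- `p` is differentiable in space (one-sidedly at the boundary), with derivative `px`. -/
  p_x : ∀ t ∈ Set.Ioc 0 T, ∀ x, y t ≤ x →
    HasDerivWithinAt (fun z => p t z) (px t x) (Set.Ici (y t)) x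
  /-- `px` is differentiable in space for `x > y(t)`, with derivative `pxx`. -/
  p_xx : ∀ t ∈ Set.Ioc 0 T, ∀ x, y t < x →
    HasDerivWithinAt (fun z => px t z) (pxx t x) (Set.Ici (y t)) x
  /-- `pt` and `pxx` are continuous in space above the barrier: `p(t,·) ∈ C²`,
  `p(·,x) ∈ C¹`. -/
  pt_pxx_cont : ∀ t ∈ Set.Ioc 0 T,
    ContinuousOn (fun z => pt t z) (Set.Ioi (y t)) ∧
    ContinuousOn (fun z => pxx t z) (Set.Ioi (y t))
  /-- `p(t,·)` is nonnegative. -/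
  p_nonneg : ∀ t ∈ Set.Ioc 0 T, ∀ x, 0 ≤ p t x
  /-- `p(t,·)` is supported on `[y(t), ∞)`. -/
  p_support : ∀ t ∈ Set.Ioc 0 T, ∀ x, x < y t → p t x = 0
  /-- `p(t,·)` is a probability density. -/
  p_mass : ∀ t ∈ Set.Ioc 0 T, ∫ x, p t x = 1
  /-- Heat equation `∂_t p = (1/2) ∂²_{xx} p` in `{x > y(t)}`. -/
  heat : ∀ t ∈ Set.Ioc 0 T, ∀ x, y t < x → pt t x = (1 / 2) * pxx t x
  /-- Insulating boundary condition `∂⁺_x p(t, y(t)) = -2 y'(t) p(t, y(t))`. -/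
  boundary : ∀ t ∈ Set.Ioc 0 T, px t (y t) = -2 * y' t * p t (y t)
  /-- Barrier acceleration law `y''(t) = -(K/2) p(t, y(t))`. -/
  accel : ∀ t ∈ Set.Ioc 0 T, y'' t = -(K / 2) * p t (y t)
  /-- Initial condition: `p(t,x) dx → π₀` weakly as `t ↓ 0`. -/
  init : ∀ g : BoundedContinuousFunction ℝ ℝ,
    Tendsto (fun t => ∫ x, g x * p t x) (nhdsWithin 0 (Set.Ioi 0))
      (nhds (∫ x, g x ∂π₀))

section Helpers
open Topology

/-- Classical smooth caloric functions on the plane. -/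
structure Cal (u ux uxx : ℝ → ℝ → ℝ) : Prop where
  dt : ∀ t x, HasDerivAt (fun s => u s x) (1 / 2 * uxx t x) t
  dx : ∀ t x, HasDerivAt (u t) (ux t x) x
  dxx : ∀ t x, HasDerivAt (ux t) (uxx t x) x
  cont : Continuous (fun q : ℝ × ℝ => u q.1 q.2)
  contxx : Continuous (fun q : ℝ × ℝ => uxx q.1 q.2)

def IsCal (u : ℝ → ℝ → ℝ) : Prop := ∃ ux uxx, Cal u ux uxx

lemma IsCal.add {u v : ℝ → ℝ → ℝ} (hu : IsCal u) (hv : IsCal v) :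
    IsCal (fun t x => u t x + v t x) := by
  obtain ⟨ux, uxx, hu⟩ := hu
  obtain ⟨vx, vxx, hv⟩ := hv
  refine ⟨fun t x => ux t x + vx t x, fun t x => uxx t x + vxx t x, ?_, ?_, ?_, ?_, ?_⟩
  · intro t x
    have := (hu.dt t x).add (hv.dt t x)
    rw [← mul_add] at this
    exact this
  · exact fun t x => (hu.dx t x).add (hv.dx t x)
  · exact fun t x => (hu.dxx t x).add (hv.dxx t x)
  · exact hu.cont.add hv.cont
  · exact hu.contxx.add hv.contxx

lemma IsCal.smul {u : ℝ → ℝ → ℝ} (c : ℝ) (hu : IsCal u) :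
    IsCal (fun t x => c * u t x) := by
  obtain ⟨ux, uxx, hu⟩ := hu
  refine ⟨fun t x => c * ux t x, fun t x => c * uxx t x, ?_, ?_, ?_, ?_, ?_⟩
  · intro t x
    have := (hu.dt t x).const_mul c
    rw [mul_left_comm] at this
    exact this
  · exact fun t x => (hu.dx t x).const_mul c
  · exact fun t x => (hu.dxx t x).const_mul c
  · exact hu.cont.const_mul c
  · exact hu.contxx.const_mul c

lemma isCal_exp (l s : ℝ) (w w' : ℝ → ℝ) (h1 : ∀ x, HasDerivAt w (w' x) x)
    (h2 : ∀ x, HasDerivAt w' (2 * l * w x) x) :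
    IsCal (fun t x => Real.exp (l * (t - s)) * w x) := by
  have hw : Continuous w := continuous_iff_continuousAt.2 fun x => (h1 x).continuousAt
  refine ⟨fun t x => Real.exp (l * (t - s)) * w' x,
    fun t x => Real.exp (l * (t - s)) * (2 * l * w x), ?_, ?_, ?_, ?_, ?_⟩
  · intro t x
    have : HasDerivAt (fun t => Real.exp (l * (t - s)) * w x)
      (Real.exp (l * (t - s)) * (l * 1) * w x) t :=
      ((((hasDerivAt_id t).sub_const s).const_mul l).exp).mul_const _
    convert this using 1; ring
  · exact fun t x => (h1 x).const_mul _
  · exact fun t x => (h2 x).const_mul _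
  · fun_prop
  · fun_prop

/-- Second derivative at a local maximum cannot be positive. -/
lemma second_deriv_max {g g' : ℝ → ℝ} {x g'' : ℝ} (h1 : ∀ᶠ z in 𝓝 x, HasDerivAt g (g' z) z)
    (h2 : HasDerivAt g' g'' x) (hm : IsLocalMax g x) : g'' ≤ 0 := by
  by_contra hpos
  push Not at hpos
  have e1 : deriv g =ᶠ[𝓝 x] g' := h1.mono fun z hz => hz.deriv
  have e2 : deriv (deriv g) x = g'' := by rw [e1.deriv_eq]; exact h2.deriv
  have hmin : IsLocalMin g x := by
    apply isLocalMin_of_deriv_deriv_pos (by rw [e2]; exact hpos) hm.deriv_eq_zero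
    exact h1.self_of_nhds.continuousAt
  have hconst : g =ᶠ[𝓝 x] fun _ => g x := by
    filter_upwards [hm, hmin] with z hz1 hz2
    exact le_antisymm hz1 hz2
  have e3 : deriv (deriv g) x = 0 := by
    have := hconst.deriv
    rw [this.deriv_eq]
    simp
  rw [e2] at e3
  exact hpos.ne' e3

/-- Weak maximum principle on a rectangle. -/
lemma max_principle {s1 s2 c d M : ℝ} (w wx wxx : ℝ → ℝ → ℝ)
    (hc : ContinuousOn (fun q : ℝ × ℝ => w q.1 q.2) (Icc s1 s2 ×ˢ Icc c d))
    (ht : ∀ t ∈ Ioc s1 s2, ∀ x ∈ Ioo c d,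
      HasDerivWithinAt (fun s => w s x) (1 / 2 * wxx t x) (Ioc s1 t) t)
    (hx : ∀ t ∈ Ioc s1 s2, ∀ x ∈ Ioo c d, HasDerivAt (w t) (wx t x) x)
    (hxx : ∀ t ∈ Ioc s1 s2, ∀ x ∈ Ioo c d, HasDerivAt (wx t) (wxx t x) x)
    (h0 : ∀ x ∈ Icc c d, w s1 x ≤ M)
    (hl : ∀ t ∈ Icc s1 s2, w t c ≤ M) (hr : ∀ t ∈ Icc s1 s2, w t d ≤ M) :
    ∀ t ∈ Icc s1 s2, ∀ x ∈ Icc c d, w t x ≤ M := by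
  intro t ht0 x hx0
  by_contra hcon
  push Not at hcon
  have hs : s1 < t := by
    rcases ht0.1.eq_or_lt with h | h
    · subst h; exact absurd (h0 x hx0) (not_le.2 hcon)
    · exact h
  -- perturb
  set δ : ℝ := (w t x - M) / (2 * (s2 - s1)) with hδ
  have hss : 0 < s2 - s1 := by linarith [ht0.2]
  have hδpos : 0 < δ := by apply div_pos <;> linarith
  have hδ2 : δ * (s2 - s1) < w t x - M := by
    rw [hδ]; field_simp; linarith
  set v : ℝ × ℝ → ℝ := fun q => w q.1 q.2 - δ * (q.1 - s1) with hv
  have hvc : ContinuousOn v (Icc s1 s2 ×ˢ Icc c d) := by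
    apply hc.sub; fun_prop
  obtain ⟨⟨a, z⟩, hq, hmax⟩ := (isCompact_Icc.prod isCompact_Icc).exists_isMaxOn ⟨(t, x), ht0, hx0⟩ hvc
  have hvM : M < v (a, z) := by
    have h1 : v (t, x) ≤ v (a, z) := hmax (show (t, x) ∈ Icc s1 s2 ×ˢ Icc c d from ⟨ht0, hx0⟩)
    have h2 : δ * (t - s1) ≤ δ * (s2 - s1) := by gcongr; exact ht0.2
    simp only [hv] at h1 ⊢
    linarith
  have ha : a ∈ Icc s1 s2 := hq.1
  have hz : z ∈ Icc c d := hq.2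
  have hpos : 0 ≤ δ * (a - s1) := mul_nonneg hδpos.le (by linarith [ha.1])
  have hwM : M < w a z := by simp only [hv] at hvM; linarith
  have ha1 : s1 < a := by
    rcases ha.1.eq_or_lt with h | h
    · subst h; exact absurd (h0 z hz) (not_le.2 hwM)
    · exact h
  have hz1 : c < z := by
    rcases hz.1.eq_or_lt with h | h
    · subst h; exact absurd (hl a ha) (not_le.2 hwM)
    · exact h
  have hz2 : z < d := by
    rcases hz.2.eq_or_lt with h | h
    · subst h; exact absurd (hr a ha) (not_le.2 hwM)
    · exact h
  have haI : a ∈ Ioc s1 s2 := ⟨ha1, ha.2⟩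
  have hwxx : wxx a z ≤ 0 := by
    apply second_deriv_max (g := w a) (g' := wx a) (x := z)
    · filter_upwards [Ioo_mem_nhds hz1 hz2] with r hr using hx a haI r hr
    · exact hxx a haI z ⟨hz1, hz2⟩
    · filter_upwards [Ioo_mem_nhds hz1 hz2] with r hr
      have : v (a, r) ≤ v (a, z) := hmax (show (a, r) ∈ Icc s1 s2 ×ˢ Icc c d from ⟨ha, hr.1.le, hr.2.le⟩)
      simp only [hv] at this
      linarith
  have hwt : δ ≤ 1 / 2 * wxx a z := by
    have hd := ht a haI z ⟨hz1, hz2⟩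
    rw [hasDerivWithinAt_iff_tendsto_slope] at hd
    have hset : Ioc s1 a \ {a} = Ioo s1 a := by
      ext r; simp only [Set.mem_sdiff, mem_Ioc, mem_singleton_iff, mem_Ioo]
      constructor
      · rintro ⟨⟨h1, h2⟩, h3⟩; exact ⟨h1, lt_of_le_of_ne h2 h3⟩
      · rintro ⟨h1, h2⟩; exact ⟨⟨h1, h2.le⟩, h2.ne⟩
    rw [hset] at hd
    have : (𝓝[Ioo s1 a] a).NeBot := by
      rw [nhdsWithin_Ioo_eq_nhdsLT ha1]; infer_instance
    apply ge_of_tendsto hd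
    filter_upwards [self_mem_nhdsWithin] with r hr
    have h1 : v (r, z) ≤ v (a, z) := hmax (show (r, z) ∈ Icc s1 s2 ×ˢ Icc c d from
      ⟨⟨hr.1.le, hr.2.le.trans ha.2⟩, hz⟩)
    simp only [hv] at h1
    rw [slope_def_field, le_div_iff_of_neg (by linarith [hr.2])]
    nlinarith
  linarith

lemma lateral_mono {e0 e1 : ℝ} (h : e0 ≠ e1) (k : ℕ) :
    ∃ u, IsCal u ∧ (∀ t, u t e0 = Real.exp t ^ k) ∧ ∀ t, u t e1 = 0 := by
  have hne : e1 - e0 ≠ 0 := sub_ne_zero.2 h.symm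
  rcases Nat.eq_zero_or_pos k with hk | hk
  · subst hk
    refine ⟨fun t x => Real.exp (0 * (t - 0)) * ((e1 - x) / (e1 - e0)), ?_, ?_, ?_⟩
    · apply isCal_exp 0 0 (fun x => (e1 - x) / (e1 - e0)) (fun _ => -1 / (e1 - e0))
      · intro x
        exact ((hasDerivAt_id x).const_sub e1).div_const _
      · intro x
        simpa using hasDerivAt_const x (-1 / (e1 - e0))
    · intro t; simp [div_self hne]
    · intro t; simp
  · set μ := √(2 * k) with hμ
    have hkR : (0 : ℝ) < k := by exact_mod_cast hk
    have hμpos : 0 < μ := Real.sqrt_pos.2 (by positivity)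
    have hμ2 : μ ^ 2 = 2 * k := Real.sq_sqrt (by positivity)
    have hsh : Real.sinh (μ * (e1 - e0)) ≠ 0 := by
      rw [Ne, Real.sinh_eq_zero]; exact mul_ne_zero hμpos.ne' hne
    refine ⟨fun t x => Real.exp (k * (t - 0)) * (Real.sinh (μ * (e1 - x)) / Real.sinh (μ * (e1 - e0))), ?_, ?_, ?_⟩
    · apply isCal_exp k 0 (fun x => Real.sinh (μ * (e1 - x)) / Real.sinh (μ * (e1 - e0)))
        (fun x => Real.cosh (μ * (e1 - x)) * (μ * -1) / Real.sinh (μ * (e1 - e0)))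
      · intro x
        exact ((((hasDerivAt_id x).const_sub e1).const_mul μ).sinh).div_const _
      · intro x
        have := (((((hasDerivAt_id x).const_sub e1).const_mul μ).cosh).mul_const (μ * -1)).div_const (Real.sinh (μ * (e1 - e0)))
        refine this.congr_deriv ?_
        rw [← hμ2]; simp only [id]; ring
    · intro t; simp [div_self hsh, ← Real.exp_nat_mul]
    · intro t; simp

lemma lateral_poly {e0 e1 : ℝ} (h : e0 ≠ e1) (Q : Polynomial ℝ) :
    ∃ u, IsCal u ∧ (∀ t, u t e0 = Q.eval (Real.exp t)) ∧ ∀ t, u t e1 = 0 := by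
  induction Q using Polynomial.induction_on' with
  | add p q hp hq =>
    obtain ⟨u, hu, hu1, hu2⟩ := hp
    obtain ⟨v, hv, hv1, hv2⟩ := hq
    exact ⟨_, hu.add hv, fun t => by simp [hu1, hv1], fun t => by simp [hu2, hv2]⟩
  | monomial n a =>
    obtain ⟨u, hu, hu1, hu2⟩ := lateral_mono h n
    exact ⟨_, hu.smul a, fun t => by simp [hu1], fun t => by simp [hu2]⟩

lemma lateral_approx {e0 e1 s1 s2 ε : ℝ} (h : e0 ≠ e1) (hε : 0 < ε) (g : ℝ → ℝ)
    (hg : ContinuousOn g (Icc s1 s2)) :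
    ∃ u, IsCal u ∧ (∀ t ∈ Icc s1 s2, |u t e0 - g t| < ε) ∧ ∀ t, u t e1 = 0 := by
  have hc : ContinuousOn (fun q => g (Real.log q)) (Icc (Real.exp s1) (Real.exp s2)) := by
    apply hg.comp (Real.continuousOn_log.mono _)
    · intro q hq
      have : 0 < q := (Real.exp_pos _).trans_le hq.1
      exact ⟨(Real.le_log_iff_exp_le this).2 hq.1, (Real.log_le_iff_le_exp this).2 hq.2⟩
    · intro q hq
      exact ((Real.exp_pos _).trans_le hq.1).ne'
  obtain ⟨Q, hQ⟩ := exists_polynomial_near_of_continuousOn _ _ _ hc ε hε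
  obtain ⟨u, hu, hu1, hu2⟩ := lateral_poly h Q
  refine ⟨u, hu, ?_, hu2⟩
  intro t ht
  have := hQ (Real.exp t) ⟨Real.exp_le_exp.2 ht.1, Real.exp_le_exp.2 ht.2⟩
  rwa [Real.log_exp, ← hu1] at this

lemma sine_mode {c d s : ℝ} (h : c < d) (n : ℕ) : ∀ j : ℤ,
    ∃ u, IsCal u ∧ (∀ x, u s x = Real.sin (j * (Real.pi * ((x - c) / (d - c)))) *
      Real.cos (Real.pi * ((x - c) / (d - c))) ^ n) ∧ (∀ t, u t c = 0) ∧ ∀ t, u t d = 0 := by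
  have hne : d - c ≠ 0 := (sub_pos.2 h).ne'
  induction n with
  | zero =>
    intro j
    set μ : ℝ := j * (Real.pi / (d - c)) with hμ
    refine ⟨fun t x => Real.exp (-(μ ^ 2 / 2) * (t - s)) * Real.sin (μ * (x - c)), ?_, ?_, ?_, ?_⟩
    · apply isCal_exp (-(μ ^ 2 / 2)) s (fun x => Real.sin (μ * (x - c)))
        (fun x => Real.cos (μ * (x - c)) * (μ * 1))
      · intro x
        exact (((hasDerivAt_id x).sub_const c).const_mul μ).sin
      · intro x
        have := ((((hasDerivAt_id x).sub_const c).const_mul μ).cos).mul_const (μ * 1)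
        refine this.congr_deriv ?_
        simp only [id]; ring
    · intro x
      simp only [sub_self, mul_zero, Real.exp_zero, one_mul, pow_zero, mul_one, hμ]
      congr 1; ring
    · intro t; simp
    · intro t
      have : μ * (d - c) = j * Real.pi := by rw [hμ]; field_simp
      simp [this, Real.sin_int_mul_pi]
  | succ n ih =>
    intro j
    obtain ⟨u, hu, hu1, hu2, hu3⟩ := ih (j + 1)
    obtain ⟨v, hv, hv1, hv2, hv3⟩ := ih (j - 1)
    refine ⟨_, (hu.add hv).smul (1 / 2), ?_, ?_, ?_⟩
    · intro x
      rw [hu1, hv1]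
      push_cast
      rw [add_mul, sub_mul, Real.sin_add, Real.sin_sub, one_mul]
      ring
    · intro t; simp [hu2, hv2]
    · intro t; simp [hu3, hv3]

lemma sine_poly {c d s : ℝ} (h : c < d) (Q : Polynomial ℝ) :
    ∃ u, IsCal u ∧ (∀ x, u s x = Real.sin (Real.pi * ((x - c) / (d - c))) *
      Q.eval (Real.cos (Real.pi * ((x - c) / (d - c))))) ∧ (∀ t, u t c = 0) ∧ ∀ t, u t d = 0 := by
  induction Q using Polynomial.induction_on' with
  | add p q hp hq =>
    obtain ⟨u, hu, hu1, hu2, hu3⟩ := hp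
    obtain ⟨v, hv, hv1, hv2, hv3⟩ := hq
    exact ⟨_, hu.add hv, fun t => by simp [hu1, hv1, mul_add], fun t => by simp [hu2, hv2],
      fun t => by simp [hu3, hv3]⟩
  | monomial n a =>
    obtain ⟨u, hu, hu1, hu2, hu3⟩ := sine_mode (s := s) h n 1
    exact ⟨_, hu.smul a, fun t => by simp [hu1]; ring, fun t => by simp [hu2], fun t => by simp [hu3]⟩

/-- Soft thresholding. -/
lemma soft_threshold (ε : ℝ) (hε : 0 < ε) : ∃ σ : ℝ → ℝ, Continuous σ ∧ (∀ r, |σ r - r| ≤ ε) ∧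
    ∀ r, |r| < ε → σ r = 0 := by
  refine ⟨fun r => max (r - ε) 0 + min (r + ε) 0, by fun_prop, ?_, ?_⟩
  · intro r
    rw [abs_le]
    constructor <;> rcases le_total (r - ε) 0 with h1 | h1 <;> rcases le_total (r + ε) 0 with h2 | h2 <;>
      simp only [max_eq_left, max_eq_right, min_eq_left, min_eq_right, h1, h2] <;> linarith
  · intro r hr
    rw [abs_lt] at hr
    simp only
    rw [max_eq_right (by linarith), min_eq_right (by linarith), add_zero]

lemma initial_approx {c d s ε : ℝ} (h : c < d) (hε : 0 < ε) (r : ℝ → ℝ)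
    (hr : ContinuousOn r (Icc c d)) (hrc : r c = 0) (hrd : r d = 0) :
    ∃ u, IsCal u ∧ (∀ x ∈ Icc c d, |u s x - r x| ≤ ε) ∧ (∀ t, u t c = 0) ∧ ∀ t, u t d = 0 := by
  have hdc : 0 < d - c := sub_pos.2 h
  obtain ⟨σ, hσc, hσ1, hσ2⟩ := soft_threshold (ε / 2) (by linarith)
  set X : ℝ → ℝ := fun q => c + (d - c) * (Real.arccos q / Real.pi) with hX
  have hXc : Continuous X := by
    have := Real.continuous_arccos
    fun_prop
  have hXm : ∀ q, X q ∈ Icc c d := by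
    intro q
    have h1 : 0 ≤ Real.arccos q / Real.pi := div_nonneg (Real.arccos_nonneg q) Real.pi_pos.le
    have h2 : Real.arccos q / Real.pi ≤ 1 := (div_le_one Real.pi_pos).2 (Real.arccos_le_pi q)
    constructor <;> simp only [hX] <;> nlinarith
  have hρc : Continuous (fun q => r (X q)) := by
    rw [continuous_iff_continuousAt]
    intro q
    have := (hr (X q) (hXm q)).tendsto.comp
      (tendsto_nhdsWithin_iff.2 ⟨hXc.tendsto q, Eventually.of_forall hXm⟩)
    exact this
  have hH : Continuous (fun q => σ (r (X q)) / √(1 - q ^ 2)) := by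
    rw [continuous_iff_continuousAt]
    intro q
    by_cases hq : √(1 - q ^ 2) = 0
    · have hz : r (X q) = 0 := by
        rw [Real.sqrt_eq_zero'] at hq
        have : q ≤ -1 ∨ 1 ≤ q := by
          by_contra hcon; push Not at hcon; nlinarith
        rcases this with h' | h'
        · have : X q = d := by simp only [hX]; rw [Real.arccos_of_le_neg_one h', div_self Real.pi_pos.ne']; ring
          rw [this, hrd]
        · have : X q = c := by simp only [hX]; rw [Real.arccos_of_one_le h']; ring
          rw [this, hrc]
      have hev : ∀ᶠ z in 𝓝 q, |r (X z)| < ε / 2 := by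
        have : Tendsto (fun q => |r (X q)|) (𝓝 q) (𝓝 |r (X q)|) := hρc.abs.tendsto q
        apply this.eventually_lt_const
        rw [hz, abs_zero]; linarith
      have : (fun q => σ (r (X q)) / √(1 - q ^ 2)) =ᶠ[𝓝 q] fun _ => 0 := by
        filter_upwards [hev] with z hz
        rw [hσ2 _ hz, zero_div]
      exact (continuousAt_const).congr this.symm
    · refine ContinuousAt.div (f := fun q => σ (r (X q))) (g := fun q => √(1 - q ^ 2)) ?_ ?_ hq
      · exact (hσc.comp hρc).continuousAt
      · fun_prop
  obtain ⟨Q, hQ⟩ := exists_polynomial_near_of_continuousOn (-1) 1 _ hH.continuousOn (ε / 2) (by linarith)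
  obtain ⟨u, hu, hu1, hu2, hu3⟩ := sine_poly (s := s) h Q
  refine ⟨u, hu, ?_, hu2, hu3⟩
  intro x hx
  rw [hu1]
  set θ := Real.pi * ((x - c) / (d - c)) with hθ
  have hx1 : 0 ≤ (x - c) / (d - c) := div_nonneg (by linarith [hx.1]) hdc.le
  have hx2 : (x - c) / (d - c) ≤ 1 := (div_le_one hdc).2 (by linarith [hx.2])
  have hθ0 : 0 ≤ θ := mul_nonneg Real.pi_pos.le hx1
  have hθ1 : θ ≤ Real.pi := by nlinarith [Real.pi_pos]
  have hXx : X (Real.cos θ) = x := by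
    simp only [hX]; rw [Real.arccos_cos hθ0 hθ1, hθ]
    field_simp; ring
  have hsin : √(1 - Real.cos θ ^ 2) = Real.sin θ := by
    rw [← Real.sin_sq θ, Real.sqrt_sq (Real.sin_nonneg_of_nonneg_of_le_pi hθ0 hθ1)]
  have hs0 := Real.sin_nonneg_of_nonneg_of_le_pi hθ0 hθ1
  have h1 := hQ (Real.cos θ) ⟨Real.neg_one_le_cos θ, Real.cos_le_one θ⟩
  simp only [hXx, hsin] at h1
  have h2 := hσ1 (r x)
  have h3 : Real.sin θ * (σ (r x) / Real.sin θ) = σ (r x) := by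
    by_cases h0 : Real.sin θ = 0
    · have hz : r x = 0 := by
        rcases hθ0.eq_or_lt with h' | h'
        · have : x = c := by
            have : (x - c) / (d - c) = 0 := by
              rcases mul_eq_zero.1 (h'.symm.trans rfl) with h'' | h''
              · exact absurd h'' Real.pi_pos.ne'
              · exact h''
            rw [div_eq_zero_iff] at this
            rcases this with h'' | h'' <;> linarith
          rw [this, hrc]
        · rcases hθ1.eq_or_lt with h'' | h''
          · have : x = d := by
              rw [← hXx, h'']; simp only [hX]; rw [Real.arccos_cos Real.pi_pos.le le_rfl, div_self Real.pi_pos.ne']; ring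
            rw [this, hrd]
          · exact absurd h0 (Real.sin_pos_of_pos_of_lt_pi h' h'').ne'
      rw [hz, hσ2 0 (by simpa using hε), h0]; simp
    · field_simp
  have h4 : |Real.sin θ * Q.eval (Real.cos θ) - σ (r x)| ≤ ε / 2 := by
    rw [← h3, ← mul_sub, abs_mul, abs_of_nonneg hs0]
    nlinarith [Real.sin_le_one θ, abs_nonneg (Polynomial.eval (Real.cos θ) Q - σ (r x) / Real.sin θ)]
  calc _ = |(Real.sin θ * Q.eval (Real.cos θ) - σ (r x)) + (σ (r x) - r x)| := by ring_nf
    _ ≤ _ := abs_add_le _ _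
    _ ≤ ε := by linarith

/-- A pointwise solution of the heat equation is a uniform limit of smooth caloric functions on
rectangles. -/
lemma caloric_approx {s1 s2 c d ε : ℝ} (hs : s1 ≤ s2) (h : c < d) (hε : 0 < ε) (w wx wxx : ℝ → ℝ → ℝ)
    (hc : ContinuousOn (fun q : ℝ × ℝ => w q.1 q.2) (Icc s1 s2 ×ˢ Icc c d))
    (ht : ∀ t ∈ Ioc s1 s2, ∀ x ∈ Ioo c d,
      HasDerivWithinAt (fun s => w s x) (1 / 2 * wxx t x) (Ioc s1 t) t)
    (hx : ∀ t ∈ Ioc s1 s2, ∀ x ∈ Ioo c d, HasDerivAt (w t) (wx t x) x)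
    (hxx : ∀ t ∈ Ioc s1 s2, ∀ x ∈ Ioo c d, HasDerivAt (wx t) (wxx t x) x) :
    ∃ u, IsCal u ∧ ∀ t ∈ Icc s1 s2, ∀ x ∈ Icc c d, |u t x - w t x| ≤ ε := by
  have hdc : 0 < d - c := sub_pos.2 h
  have hgc : ∀ e ∈ Icc c d, ContinuousOn (fun t => w t e) (Icc s1 s2) := by
    intro e he
    exact hc.comp (f := fun t => (t, e)) (by fun_prop) fun t ht => ⟨ht, he⟩
  obtain ⟨u1, hu1, hu1c, hu1d⟩ := lateral_approx h.ne (half_pos hε) _ (hgc c ⟨le_rfl, h.le⟩)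
  obtain ⟨u2, hu2, hu2d, hu2c⟩ := lateral_approx h.ne' (half_pos hε) _ (hgc d ⟨h.le, le_rfl⟩)
  have hs1 : s1 ∈ Icc s1 s2 := ⟨le_rfl, hs⟩
  have hcont : ∀ {u : ℝ → ℝ → ℝ}, IsCal u → Continuous (fun x => u s1 x) := by
    rintro u ⟨ux, uxx, hu⟩
    exact hu.cont.comp (by fun_prop : Continuous fun x : ℝ => (s1, x))
  set R : ℝ → ℝ := fun x => w s1 x - u1 s1 x - u2 s1 x with hR
  have hRc : ContinuousOn R (Icc c d) := by
    refine (ContinuousOn.sub ?_ (hcont hu1).continuousOn).sub (hcont hu2).continuousOn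
    exact hc.comp (f := fun x => (s1, x)) (by fun_prop) fun x hx => ⟨hs1, hx⟩
  set l : ℝ → ℝ := fun x => R c * ((d - x) / (d - c)) + R d * ((x - c) / (d - c)) with hl
  have hlc : Continuous l := by fun_prop
  obtain ⟨u3, hu3, hu3a, hu3c, hu3d⟩ := initial_approx (s := s1) h (half_pos hε) (fun x => R x - l x)
    (hRc.sub hlc.continuousOn) (by simp [hl, div_self hdc.ne']) (by simp [hl, div_self hdc.ne'])
  have hRc' : |R c| ≤ ε / 2 := by
    simp only [hR, hu2c]; rw [abs_sub_comm] ; 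
    have := (hu1c s1 hs1).le
    rw [abs_le] at *
    constructor <;> linarith
  have hRd' : |R d| ≤ ε / 2 := by
    simp only [hR, hu1d]
    have := (hu2d s1 hs1).le
    rw [abs_le] at *
    constructor <;> linarith
  have hlb : ∀ x ∈ Icc c d, |l x| ≤ ε / 2 := by
    intro x hx
    have h1 : 0 ≤ (d - x) / (d - c) := div_nonneg (by linarith [hx.2]) hdc.le
    have h2 : 0 ≤ (x - c) / (d - c) := div_nonneg (by linarith [hx.1]) hdc.le
    have h3 : (d - x) / (d - c) + (x - c) / (d - c) = 1 := by field_simp; ring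
    rw [abs_le] at *
    simp only [hl]
    constructor <;> nlinarith
  have hU := (hu1.add hu2).add hu3
  refine ⟨_, hU, ?_⟩
  obtain ⟨Ux, Uxx, hU⟩ := hU
  -- boundary estimates
  have b0 : ∀ x ∈ Icc c d, |u1 s1 x + u2 s1 x + u3 s1 x - w s1 x| ≤ ε := by
    intro x hx
    have h1 := hu3a x hx
    have h2 := hlb x hx
    simp only [hR] at h1
    rw [abs_le] at *
    constructor <;> linarith
  have bl : ∀ t ∈ Icc s1 s2, |u1 t c + u2 t c + u3 t c - w t c| ≤ ε := by
    intro t ht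
    have h1 := (hu1c t ht).le
    rw [hu2c, hu3c]
    rw [abs_le] at *
    constructor <;> linarith
  have br : ∀ t ∈ Icc s1 s2, |u1 t d + u2 t d + u3 t d - w t d| ≤ ε := by
    intro t ht
    have h1 := (hu2d t ht).le
    rw [hu1d, hu3d]
    rw [abs_le] at *
    constructor <;> linarith
  have m1 := max_principle (s1 := s1) (s2 := s2) (c := c) (d := d) (M := ε)
    (fun t x => u1 t x + u2 t x + u3 t x - w t x) (fun t x => Ux t x - wx t x) (fun t x => Uxx t x - wxx t x)
    (hU.cont.continuousOn.sub hc)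
    (fun t ht' x hx' => by
      have := (hU.dt t x).hasDerivWithinAt.sub (ht t ht' x hx')
      rw [← mul_sub] at this; exact this)
    (fun t ht' x hx' => (hU.dx t x).sub (hx t ht' x hx'))
    (fun t ht' x hx' => (hU.dxx t x).sub (hxx t ht' x hx'))
    (fun x hx => (abs_le.1 (b0 x hx)).2) (fun t ht => (abs_le.1 (bl t ht)).2)
    (fun t ht => (abs_le.1 (br t ht)).2)
  have m2 := max_principle (s1 := s1) (s2 := s2) (c := c) (d := d) (M := ε)
    (fun t x => w t x - (u1 t x + u2 t x + u3 t x)) (fun t x => wx t x - Ux t x) (fun t x => wxx t x - Uxx t x)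
    (hc.sub hU.cont.continuousOn)
    (fun t ht' x hx' => by
      have := (ht t ht' x hx').sub (hU.dt t x).hasDerivWithinAt
      rw [← mul_sub] at this; exact this)
    (fun t ht' x hx' => (hx t ht' x hx').sub (hU.dx t x))
    (fun t ht' x hx' => (hxx t ht' x hx').sub (hU.dxx t x))
    (fun x hx => by linarith [(abs_le.1 (b0 x hx)).1]) (fun t ht => by linarith [(abs_le.1 (bl t ht)).1])
    (fun t ht => by linarith [(abs_le.1 (br t ht)).1])
  intro t ht x hx
  rw [abs_le]
  constructor
  · linarith [m2 t ht x hx]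
  · exact m1 t ht x hx

/-- Test functions on the time interval `[a,b]`. -/
structure TestFn (a b : ℝ) (ψ ψt ψx ψxx : ℝ → ℝ → ℝ) : Prop where
  dt : ∀ t ∈ Icc a b, ∀ x, HasDerivWithinAt (fun s => ψ s x) (ψt t x) (Icc a b) t
  dx : ∀ t ∈ Icc a b, ∀ x, HasDerivAt (ψ t) (ψx t x) x
  dxx : ∀ t ∈ Icc a b, ∀ x, HasDerivAt (ψx t) (ψxx t x) x
  c : Continuous (fun q : ℝ × ℝ => ψ q.1 q.2)
  ct : Continuous (fun q : ℝ × ℝ => ψt q.1 q.2)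
  cxx : Continuous (fun q : ℝ × ℝ => ψxx q.1 q.2)

lemma cont_fix {f : ℝ → ℝ → ℝ} (h : Continuous (fun q : ℝ × ℝ => f q.1 q.2)) (t : ℝ) :
    Continuous (f t) := h.comp (by fun_prop : Continuous fun x : ℝ => (t, x))

lemma cont_fix' {f : ℝ → ℝ → ℝ} (h : Continuous (fun q : ℝ × ℝ => f q.1 q.2)) (x : ℝ) :
    Continuous (fun t => f t x) := h.comp (by fun_prop : Continuous fun t : ℝ => (t, x))

lemma ii_mul {f g : ℝ → ℝ} (hf : Continuous f) (hg : Continuous g) (c d : ℝ) :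
    IntervalIntegrable (fun x => f x * g x) volume c d := (hf.mul hg).intervalIntegrable _ _

lemma weak_smooth {a b s1 s2 c d : ℝ} {ψ ψt ψx ψxx u ux uxx : ℝ → ℝ → ℝ}
    (hψ : TestFn a b ψ ψt ψx ψxx) (hu : Cal u ux uxx) (h1 : a ≤ s1) (h12 : s1 ≤ s2) (h2 : s2 ≤ b)
    (hc0 : ∀ t ∈ Icc s1 s2, ψ t c = 0 ∧ ψx t c = 0 ∧ ψ t d = 0 ∧ ψx t d = 0) :
    (∫ x in c..d, ψ s2 x * u s2 x) - (∫ x in c..d, ψ s1 x * u s1 x) =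
      ∫ t in s1..s2, ∫ x in c..d, u t x * (ψt t x + 1 / 2 * ψxx t x) := by
  have cu := hu.cont
  have cuxx := hu.contxx
  have cψ := hψ.c
  have cψt := hψ.ct
  have cψxx := hψ.cxx
  have hG : Continuous (fun q : ℝ × ℝ => ψt q.1 q.2 * u q.1 q.2 + ψ q.1 q.2 * (1 / 2 * uxx q.1 q.2)) := by
    fun_prop
  have e1 : ∀ x, ψ s2 x * u s2 x - ψ s1 x * u s1 x =
      ∫ t in s1..s2, (ψt t x * u t x + ψ t x * (1 / 2 * uxx t x)) := by
    intro x
    rw [intervalIntegral.integral_eq_sub_of_hasDerivAt_of_le h12 (f := fun t => ψ t x * u t x)]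
    · exact ((cont_fix' cψ x).mul (cont_fix' cu x)).continuousOn
    · intro t ht
      have : HasDerivAt (fun s => ψ s x) (ψt t x) t :=
        (hψ.dt t ⟨h1.trans ht.1.le, ht.2.le.trans h2⟩ x).hasDerivAt
          (Icc_mem_nhds (h1.trans_lt ht.1) (ht.2.trans_le h2))
      exact this.mul (hu.dt t x)
    · exact (hG.comp (by fun_prop : Continuous fun t : ℝ => (t, x))).intervalIntegrable _ _
  rw [← intervalIntegral.integral_sub
    (ii_mul (cont_fix cψ s2) (cont_fix cu s2) _ _)
    (ii_mul (cont_fix cψ s1) (cont_fix cu s1) _ _)]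
  simp_rw [e1]
  rw [intervalIntegral_intervalIntegral_swap]
  · apply intervalIntegral.integral_congr
    intro t ht
    rw [uIcc_of_le h12] at ht
    have htab : t ∈ Icc a b := ⟨h1.trans ht.1, ht.2.trans h2⟩
    obtain ⟨z1, z2, z3, z4⟩ := hc0 t ht
    have cψx : Continuous (ψx t) := continuous_iff_continuousAt.2 fun x => (hψ.dxx t htab x).continuousAt
    have cux : Continuous (ux t) := continuous_iff_continuousAt.2 fun x => (hu.dxx t x).continuousAt
    have i1 : ∫ x in c..d, ψ t x * uxx t x = - ∫ x in c..d, ψx t x * ux t x := by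
      rw [intervalIntegral.integral_mul_deriv_eq_deriv_mul (u := ψ t) (v := ux t) (u' := ψx t) (v' := uxx t)
        (fun x _ => hψ.dx t htab x) (fun x _ => hu.dxx t x)
        (cψx.intervalIntegrable _ _) ((cont_fix cuxx t).intervalIntegrable _ _), z1, z3]
      ring
    have i2 : ∫ x in c..d, ψx t x * ux t x = - ∫ x in c..d, ψxx t x * u t x := by
      rw [intervalIntegral.integral_mul_deriv_eq_deriv_mul (u := ψx t) (v := u t) (u' := ψxx t) (v' := ux t)
        (fun x _ => hψ.dxx t htab x) (fun x _ => hu.dx t x)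
        ((cont_fix cψxx t).intervalIntegrable _ _) (cux.intervalIntegrable _ _), z2, z4]
      ring
    have k1 := ii_mul (cont_fix cψt t) (cont_fix cu t) c d
    have k2 := ii_mul (cont_fix cψ t) (cont_fix cuxx t) c d
    have k3 := ii_mul (cont_fix cψxx t) (cont_fix cu t) c d
    calc ∫ x in c..d, (ψt t x * u t x + ψ t x * (1 / 2 * uxx t x))
        = ∫ x in c..d, (ψt t x * u t x + (1 / 2) * (ψ t x * uxx t x)) := by
          congr 1; ext x; ring
      _ = (∫ x in c..d, ψt t x * u t x) + (1 / 2) * ∫ x in c..d, ψ t x * uxx t x := by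
          rw [intervalIntegral.integral_add k1 (k2.const_mul _), intervalIntegral.integral_const_mul]
      _ = (∫ x in c..d, ψt t x * u t x) + (1 / 2) * ∫ x in c..d, ψxx t x * u t x := by
          rw [i1, i2, neg_neg]
      _ = ∫ x in c..d, (ψt t x * u t x + (1 / 2) * (ψxx t x * u t x)) := by
          rw [intervalIntegral.integral_add k1 (k3.const_mul _), intervalIntegral.integral_const_mul]
      _ = _ := by congr 1; ext x; ring
  · refine IntegrableOn.mono_set (t := uIcc c d ×ˢ uIcc s1 s2) ?_ ?_
    · apply ContinuousOn.integrableOn_compact (isCompact_uIcc.prod isCompact_uIcc)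
      exact (hG.comp continuous_swap).continuousOn
    · exact prod_mono uIoc_subset_uIcc uIoc_subset_uIcc

lemma weak_rect {a b s1 s2 c d : ℝ} {ψ ψt ψx ψxx w wx wxx : ℝ → ℝ → ℝ}
    (hψ : TestFn a b ψ ψt ψx ψxx) (h1 : a ≤ s1) (h12 : s1 ≤ s2) (h2 : s2 ≤ b) (hcd : c < d)
    (hc0 : ∀ t ∈ Icc s1 s2, ψ t c = 0 ∧ ψx t c = 0 ∧ ψ t d = 0 ∧ ψx t d = 0)
    (hw : Continuous (fun q : ℝ × ℝ => w q.1 q.2))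
    (ht : ∀ t ∈ Ioc s1 s2, ∀ x ∈ Ioo c d,
      HasDerivWithinAt (fun s => w s x) (1 / 2 * wxx t x) (Ioc s1 t) t)
    (hx : ∀ t ∈ Ioc s1 s2, ∀ x ∈ Ioo c d, HasDerivAt (w t) (wx t x) x)
    (hxx : ∀ t ∈ Ioc s1 s2, ∀ x ∈ Ioo c d, HasDerivAt (wx t) (wxx t x) x) :
    (∫ x in c..d, ψ s2 x * w s2 x) - (∫ x in c..d, ψ s1 x * w s1 x) =
      ∫ t in s1..s2, ∫ x in c..d, w t x * (ψt t x + 1 / 2 * ψxx t x) := by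
  have cψ := hψ.c
  have cψt := hψ.ct
  have cψxx := hψ.cxx
  have hL : Continuous (fun q : ℝ × ℝ => ψt q.1 q.2 + 1 / 2 * ψxx q.1 q.2) := by fun_prop
  obtain ⟨M1, hM1⟩ := (isCompact_Icc.prod (isCompact_Icc (a := c) (b := d))).exists_bound_of_continuousOn
    (s := Icc s1 s2 ×ˢ Icc c d) cψ.continuousOn
  obtain ⟨M2, hM2⟩ := (isCompact_Icc.prod (isCompact_Icc (a := c) (b := d))).exists_bound_of_continuousOn
    (s := Icc s1 s2 ×ˢ Icc c d) hL.continuousOn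
  have hs1 : s1 ∈ Icc s1 s2 := ⟨le_rfl, h12⟩
  have hs2 : s2 ∈ Icc s1 s2 := ⟨h12, le_rfl⟩
  have hcm : c ∈ Icc c d := ⟨le_rfl, hcd.le⟩
  have hM1' : 0 ≤ M1 := (norm_nonneg _).trans (hM1 (s1, c) ⟨hs1, hcm⟩)
  have hM2' : 0 ≤ M2 := (norm_nonneg _).trans (hM2 (s1, c) ⟨hs1, hcm⟩)
  rw [← sub_eq_zero]
  have key : ∀ ε : ℝ, 0 < ε → |(∫ x in c..d, ψ s2 x * w s2 x) - (∫ x in c..d, ψ s1 x * w s1 x) -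
      ∫ t in s1..s2, ∫ x in c..d, w t x * (ψt t x + 1 / 2 * ψxx t x)| ≤
      ε * (2 * (M1 * (d - c)) + M2 * (d - c) * (s2 - s1)) := by
    intro ε hε
    obtain ⟨u, ⟨ux, uxx, hu⟩, hub⟩ := caloric_approx h12 hcd hε w wx wxx hw.continuousOn ht hx hxx
    have cu := hu.cont
    have hid := weak_smooth hψ hu h1 h12 h2 hc0
    have hb : ∀ s ∈ Icc s1 s2, |(∫ x in c..d, ψ s x * w s x) - ∫ x in c..d, ψ s x * u s x| ≤ ε * (M1 * (d - c)) := by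
      intro s hs
      rw [← intervalIntegral.integral_sub
        (ii_mul (cont_fix cψ s) (cont_fix hw s) _ _)
        (ii_mul (cont_fix cψ s) (cont_fix cu s) _ _)]
      have := intervalIntegral.norm_integral_le_of_norm_le_const (a := c) (b := d) (C := M1 * ε)
        (f := fun x => ψ s x * w s x - ψ s x * u s x) ?_
      · rw [abs_of_pos (sub_pos.2 hcd)] at this
        rw [← Real.norm_eq_abs]; linarith
      · intro x hx
        rw [uIoc_of_le hcd.le] at hx
        have hx' : x ∈ Icc c d := ⟨hx.1.le, hx.2⟩
        rw [← mul_sub, norm_mul]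
        have := hub s hs x hx'
        rw [abs_sub_comm] at this
        exact mul_le_mul (hM1 (s, x) ⟨hs, hx'⟩) this (norm_nonneg _) hM1'
    have hb2 : |(∫ t in s1..s2, ∫ x in c..d, w t x * (ψt t x + 1 / 2 * ψxx t x)) -
        ∫ t in s1..s2, ∫ x in c..d, u t x * (ψt t x + 1 / 2 * ψxx t x)| ≤ ε * (M2 * (d - c) * (s2 - s1)) := by
      have q1 : Continuous fun t => ∫ x in c..d, w t x * (ψt t x + 1 / 2 * ψxx t x) :=
        intervalIntegral.continuous_parametric_intervalIntegral_of_continuous' (by fun_prop) _ _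
      have q2 : Continuous fun t => ∫ x in c..d, u t x * (ψt t x + 1 / 2 * ψxx t x) :=
        intervalIntegral.continuous_parametric_intervalIntegral_of_continuous' (by fun_prop) _ _
      rw [← intervalIntegral.integral_sub (q1.intervalIntegrable _ _) (q2.intervalIntegrable _ _)]
      have := intervalIntegral.norm_integral_le_of_norm_le_const (a := s1) (b := s2) (C := M2 * ε * (d - c))
        (f := fun t => (∫ x in c..d, w t x * (ψt t x + 1 / 2 * ψxx t x)) -
          ∫ x in c..d, u t x * (ψt t x + 1 / 2 * ψxx t x)) ?_
      · rw [abs_of_nonneg (sub_nonneg.2 h12)] at this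
        rw [← Real.norm_eq_abs]; linarith
      · intro s hs
        rw [uIoc_of_le h12] at hs
        have hs' : s ∈ Icc s1 s2 := ⟨hs.1.le, hs.2⟩
        rw [← intervalIntegral.integral_sub
          (ii_mul (cont_fix hw s) (cont_fix (f := fun t x => ψt t x + 1 / 2 * ψxx t x) hL s) _ _)
          (ii_mul (cont_fix cu s) (cont_fix (f := fun t x => ψt t x + 1 / 2 * ψxx t x) hL s) _ _)]
        have := intervalIntegral.norm_integral_le_of_norm_le_const (a := c) (b := d) (C := M2 * ε)
          (f := fun x => w s x * (ψt s x + 1 / 2 * ψxx s x) - u s x * (ψt s x + 1 / 2 * ψxx s x)) ?_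
        · rwa [abs_of_pos (sub_pos.2 hcd)] at this
        · intro x hx
          rw [uIoc_of_le hcd.le] at hx
          have hx' : x ∈ Icc c d := ⟨hx.1.le, hx.2⟩
          rw [← sub_mul, norm_mul, mul_comm]
          have := hub s hs' x hx'
          rw [abs_sub_comm] at this
          exact mul_le_mul (hM2 (s, x) ⟨hs', hx'⟩) this (norm_nonneg _) hM2'
    have b1 := hb s1 hs1
    have b2 := hb s2 hs2
    rw [abs_le] at *
    constructor <;> linarith
  by_contra hne
  have hpos := abs_pos.2 hne
  set C := 2 * (M1 * (d - c)) + M2 * (d - c) * (s2 - s1) with hC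
  have hC0 : 0 ≤ C := by
    have : 0 ≤ d - c := by linarith
    have : 0 ≤ s2 - s1 := by linarith
    positivity
  have := key (_ / (2 * (C + 1))) (div_pos hpos (by positivity))
  rw [div_mul_eq_mul_div, le_div_iff₀ (by positivity)] at this
  nlinarith

/-- Clamping. -/
noncomputable def cl (a b t : ℝ) : ℝ := max a (min t b)

lemma cl_cont (a b : ℝ) : Continuous (cl a b) := by unfold cl; fun_prop
lemma cl_mem {a b : ℝ} (h : a ≤ b) (t : ℝ) : cl a b t ∈ Icc a b :=
  ⟨le_max_left _ _, max_le h (min_le_right _ _)⟩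
lemma cl_eq {a b t : ℝ} (h : t ∈ Icc a b) : cl a b t = t := by
  unfold cl; rw [min_eq_left h.2, max_eq_right h.1]
lemma comp_cl {a b : ℝ} (h : a ≤ b) {f : ℝ → ℝ} (hf : ContinuousOn f (Icc a b)) :
    Continuous (fun t => f (cl a b t)) :=
  hf.comp_continuous (cl_cont a b) (cl_mem h)

namespace IsFBPSol
variable {K v T : ℝ} {π₀ : Measure ℝ} {p pt px pxx : ℝ → ℝ → ℝ} {y y' y'' : ℝ → ℝ}

lemma y_cont (H : IsFBPSol K v T π₀ p pt px pxx y y' y'') : ContinuousOn y (Icc 0 T) :=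
  fun t ht => (H.y_deriv t ht).continuousWithinAt

lemma y'_cont (H : IsFBPSol K v T π₀ p pt px pxx y y' y'') : ContinuousOn y' (Icc 0 T) :=
  fun t ht => (H.y'_deriv t ht).continuousWithinAt

/-- Weak formulation for test functions compactly supported above the barrier. -/
lemma weak_cpt (H : IsFBPSol K v T π₀ p pt px pxx y y' y'') {a b ε R : ℝ} (ha : 0 < a) (hab : a ≤ b)
    (hb : b ≤ T) (hε : 0 < ε) {ψ ψt ψx ψxx : ℝ → ℝ → ℝ} (hψ : TestFn a b ψ ψt ψx ψxx)
    (hs : ∀ t ∈ Icc a b, ∀ x, x ∉ Icc (y t + ε) R → ψ t x = 0 ∧ ψx t x = 0 ∧ ψt t x = 0 ∧ ψxx t x = 0) :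
    IntervalIntegrable (fun t => ∫ x, p t x * (ψt t x + 1 / 2 * ψxx t x)) volume a b ∧
    (∫ x, ψ b x * p b x) - (∫ x, ψ a x * p a x) =
      ∫ t in a..b, ∫ x, p t x * (ψt t x + 1 / 2 * ψxx t x) := by
  have hyc : ContinuousOn y (Icc a b) := H.y_cont.mono (Icc_subset_Icc ha.le hb)
  set q : ℝ → ℝ → ℝ := fun t x => p (cl a b t) (max x (y (cl a b t))) with hq
  have hqc : Continuous (fun r : ℝ × ℝ => q r.1 r.2) := by
    have hy2 := comp_cl hab hyc
    have : Continuous (fun r : ℝ × ℝ => ((cl a b r.1, max r.2 (y (cl a b r.1))) : ℝ × ℝ)) := by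
      have h1 : Continuous (fun r : ℝ × ℝ => cl a b r.1) := (cl_cont a b).comp continuous_fst
      have h2 : Continuous (fun r : ℝ × ℝ => y (cl a b r.1)) := hy2.comp continuous_fst
      exact h1.prodMk (continuous_snd.max h2)
    refine H.p_cont.comp_continuous this ?_
    intro r
    have := cl_mem hab r.1
    exact ⟨⟨ha.trans_le this.1, this.2.trans hb⟩, le_max_right _ _⟩
  have hqp : ∀ t ∈ Icc a b, ∀ x, y t ≤ x → q t x = p t x := by
    intro t ht x hx
    simp only [hq, cl_eq ht, max_eq_left hx]
  obtain ⟨m, hm⟩ := isCompact_Icc.exists_bound_of_continuousOn hyc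
  set A := -m - 1 with hA
  set B := max R A + 1 with hB
  have hAB : A < B := by have := le_max_right R A; linarith
  have hA' : ∀ t ∈ Icc a b, A < y t := by
    intro t ht
    have := hm t ht
    rw [Real.norm_eq_abs, abs_le] at this
    linarith
  have cψ := hψ.c
  have cψt := hψ.ct
  have cψxx := hψ.cxx
  set g : ℝ → ℝ := fun t => ∫ x in A..B, q t x * (ψt t x + 1 / 2 * ψxx t x) with hg
  set F : ℝ → ℝ := fun t => ∫ x in A..B, ψ t x * q t x with hF
  have hgc : Continuous g :=
    intervalIntegral.continuous_parametric_intervalIntegral_of_continuous' (by fun_prop) _ _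
  have hFc : Continuous F :=
    intervalIntegral.continuous_parametric_intervalIntegral_of_continuous' (by fun_prop) _ _
  -- full integrals
  have supp1 : ∀ t ∈ Icc a b, ∀ c d, c < y t + ε → R ≤ d →
      (∫ x, ψ t x * p t x) = ∫ x in c..d, ψ t x * q t x := by
    intro t ht c d hc hd
    have e : (fun x => ψ t x * p t x) = fun x => ψ t x * q t x := by
      ext x
      by_cases hx : y t ≤ x
      · rw [hqp t ht x hx]
      · rw [(hs t ht x (fun h => hx (by linarith [h.1]))).1]; simp
    rw [e, intervalIntegral.integral_eq_integral_of_support_subset]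
    intro x hx
    by_contra hcon
    have : x ∉ Icc (y t + ε) R := fun h => hcon ⟨by linarith [h.1], h.2.trans hd⟩
    apply hx; simp only [(hs t ht x this).1, zero_mul]
  have supp2 : ∀ t ∈ Icc a b, ∀ c d, c < y t + ε → R ≤ d →
      (∫ x, p t x * (ψt t x + 1 / 2 * ψxx t x)) = ∫ x in c..d, q t x * (ψt t x + 1 / 2 * ψxx t x) := by
    intro t ht c d hc hd
    have e : (fun x => p t x * (ψt t x + 1 / 2 * ψxx t x)) = fun x => q t x * (ψt t x + 1 / 2 * ψxx t x) := by
      ext x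
      by_cases hx : y t ≤ x
      · rw [hqp t ht x hx]
      · obtain ⟨-, -, h3, h4⟩ := hs t ht x (fun h => hx (by linarith [h.1]))
        rw [h3, h4]; simp
    rw [e, intervalIntegral.integral_eq_integral_of_support_subset]
    intro x hx
    by_contra hcon
    have : x ∉ Icc (y t + ε) R := fun h => hcon ⟨by linarith [h.1], h.2.trans hd⟩
    obtain ⟨-, -, h3, h4⟩ := hs t ht x this
    apply hx; simp only [h3, h4]; simp
  have hRB : R ≤ B := by have := le_max_left R A; linarith
  have hg' : ∀ t ∈ Icc a b, (∫ x, p t x * (ψt t x + 1 / 2 * ψxx t x)) = g t := fun t ht =>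
    supp2 t ht A B (by linarith [hA' t ht]) hRB
  have hF' : ∀ t ∈ Icc a b, (∫ x, ψ t x * p t x) = F t := fun t ht =>
    supp1 t ht A B (by linarith [hA' t ht]) hRB
  have hgii : ∀ r s, IntervalIntegrable g volume r s := fun r s => hgc.intervalIntegrable _ _
  refine ⟨(hgii a b).congr ?_, ?_⟩
  · intro t ht
    rw [uIoc_of_le hab] at ht
    exact (hg' t ⟨ht.1.le, ht.2⟩).symm
  set D : ℝ → ℝ := fun t => F t - ∫ s in a..t, g s with hD
  have hDc : Continuous D := hFc.sub (intervalIntegral.continuous_primitive hgii a)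
  have hloc : ∀ t ∈ Ico a b, HasDerivWithinAt D 0 (Ici t) t := by
    intro t0 ht0
    have ht0' : t0 ∈ Icc a b := ⟨ht0.1, ht0.2.le⟩
    have hev : ∀ᶠ s in 𝓝 t0, |y (cl a b s) - y t0| < ε / 4 := by
      have : Tendsto (fun s => |y (cl a b s) - y t0|) (𝓝 t0) (𝓝 |y (cl a b t0) - y t0|) :=
        (((comp_cl hab hyc).sub continuous_const).abs).tendsto t0
      rw [cl_eq ht0', sub_self, abs_zero] at this
      exact this.eventually_lt_const (by linarith)
    obtain ⟨δ, hδ, hδ2⟩ := Metric.eventually_nhds_iff.1 hev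
    have hDloc : D =ᶠ[𝓝[≥] t0] fun _ => D t0 := by
      have hm1 : Ico t0 (min (t0 + δ) b) ∈ 𝓝[≥] t0 :=
        Ico_mem_nhdsGE (lt_min (by linarith) ht0.2)
      filter_upwards [hm1] with s2 hs2
      have h12 : t0 ≤ s2 := hs2.1
      have hs2b : s2 ≤ b := (hs2.2.trans_le (min_le_right _ _)).le
      have hs2δ : s2 < t0 + δ := hs2.2.trans_le (min_le_left _ _)
      have hysm : ∀ s ∈ Icc t0 s2, |y s - y t0| < ε / 4 := by
        intro s hs
        have hs' : s ∈ Icc a b := ⟨ht0.1.trans hs.1, hs.2.trans hs2b⟩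
        have := hδ2 (y := s) (by rw [Real.dist_eq, abs_lt]; constructor <;> linarith [hs.1, hs.2])
        rwa [cl_eq hs'] at this
      set c := y t0 + ε / 2 with hc
      set d := max R c + 1 with hd
      have hcd : c < d := by have := le_max_right R c; linarith
      have hRd : R < d := by have := le_max_left R c; linarith
      have hcl : ∀ s ∈ Icc t0 s2, c < y s + ε ∧ y s < c := by
        intro s hs
        have := abs_lt.1 (hysm s hs)
        constructor <;> linarith
      have hin : ∀ s ∈ Icc t0 s2, s ∈ Icc a b := fun s hs => ⟨ht0.1.trans hs.1, hs.2.trans hs2b⟩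
      have hrect := weak_rect (w := q) (wx := px) (wxx := pxx) hψ ht0.1 h12 hs2b hcd
        (by
          intro t ht
          obtain ⟨h1, h2, -⟩ := hs t (hin t ht) c (fun h => by linarith [h.1, (hcl t ht).1])
          obtain ⟨h3, h4, -⟩ := hs t (hin t ht) d (fun h => by linarith [h.2])
          exact ⟨h1, h2, h3, h4⟩) hqc
        (by
          intro t ht x hx
          have ht' : t ∈ Icc t0 s2 := ⟨ht.1.le, ht.2⟩
          have htT : t ∈ Ioc 0 T := ⟨ha.trans_le (hin t ht').1, (hin t ht').2.trans hb⟩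
          have h0 := H.p_t t htT x ((hcl t ht').2.trans hx.1)
          rw [H.heat t htT x ((hcl t ht').2.trans hx.1)] at h0
          refine (h0.mono (fun s hs => ⟨?_, hs.2.trans htT.2⟩)).congr_of_mem ?_ ⟨ht.1, le_rfl⟩
          · linarith [hs.1, ht0.1]
          · intro s hs
            have hs' : s ∈ Icc t0 s2 := ⟨hs.1.le, hs.2.trans ht.2⟩
            exact hqp s (hin s hs') x ((hcl s hs').2.trans hx.1).le)
        (by
          intro t ht x hx
          have ht' : t ∈ Icc t0 s2 := ⟨ht.1.le, ht.2⟩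
          have htT : t ∈ Ioc 0 T := ⟨ha.trans_le (hin t ht').1, (hin t ht').2.trans hb⟩
          have hyx := (hcl t ht').2.trans hx.1
          have h0 := (H.p_x t htT x hyx.le).hasDerivAt (Ici_mem_nhds hyx)
          refine h0.congr_of_eventuallyEq ?_
          filter_upwards [Ici_mem_nhds hyx] with z hz
          exact hqp t (hin t ht') z hz)
        (by
          intro t ht x hx
          have ht' : t ∈ Icc t0 s2 := ⟨ht.1.le, ht.2⟩
          have htT : t ∈ Ioc 0 T := ⟨ha.trans_le (hin t ht').1, (hin t ht').2.trans hb⟩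
          have hyx := (hcl t ht').2.trans hx.1
          exact (H.p_xx t htT x hyx).hasDerivAt (Ici_mem_nhds hyx))
      have ht00 : t0 ∈ Icc t0 s2 := ⟨le_rfl, h12⟩
      have hs22 : s2 ∈ Icc t0 s2 := ⟨h12, le_rfl⟩
      have e1 : F s2 - F t0 = ∫ s in t0..s2, g s := by
        rw [← hF' s2 (hin _ hs22), ← hF' t0 (hin _ ht00), supp1 s2 (hin _ hs22) c d (hcl _ hs22).1 hRd.le,
          supp1 t0 (hin _ ht00) c d (hcl _ ht00).1 hRd.le, hrect]
        apply intervalIntegral.integral_congr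
        intro t ht
        rw [uIcc_of_le h12] at ht
        simp only
        rw [← hg' t (hin t ht), supp2 t (hin t ht) c d (hcl t ht).1 hRd.le]
      have e2 := intervalIntegral.integral_interval_sub_left (hgii a s2) (hgii a t0)
      simp only [hD]
      linarith
    exact (hasDerivWithinAt_const t0 _ (D t0)).congr_of_eventuallyEq hDloc rfl
  have hconst := constant_of_has_deriv_right_zero hDc.continuousOn hloc b ⟨hab, le_rfl⟩
  simp only [hD, intervalIntegral.integral_same, sub_zero] at hconst
  rw [hF' b ⟨hab, le_rfl⟩, hF' a ⟨le_rfl, hab⟩]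
  have e3 : (∫ t in a..b, ∫ x, p t x * (ψt t x + 1 / 2 * ψxx t x)) = ∫ t in a..b, g t := by
    apply intervalIntegral.integral_congr
    intro t ht
    rw [uIcc_of_le hab] at ht
    exact hg' t ht
  rw [e3]
  linarith

end IsFBPSol

/-- A smooth step from `0` (for `z ≤ 1`) to `1` (for `z ≥ 2`). -/
noncomputable def chi (z : ℝ) : ℝ := Real.smoothTransition (z - 1)
noncomputable def chi1 : ℝ → ℝ := deriv chi
noncomputable def chi2 : ℝ → ℝ := deriv chi1

lemma chi_contDiff : ContDiff ℝ 2 chi := by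
  unfold chi
  exact (Real.smoothTransition.contDiff (n := 2)).comp (contDiff_id.sub contDiff_const)

lemma chi_d (z : ℝ) : HasDerivAt chi (chi1 z) z :=
  (chi_contDiff.differentiable (by norm_num) z).hasDerivAt

lemma chi1_contDiff : ContDiff ℝ 1 chi1 := by
  have := chi_contDiff
  rw [show (2 : WithTop ℕ∞) = 1 + 1 by norm_num, contDiff_succ_iff_deriv] at this
  exact this.2.2

lemma chi1_d (z : ℝ) : HasDerivAt chi1 (chi2 z) z :=
  (chi1_contDiff.differentiable (by norm_num) z).hasDerivAt

lemma chi2_cont : Continuous chi2 := chi1_contDiff.continuous_deriv le_rfl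
lemma chi1_cont : Continuous chi1 := chi1_contDiff.continuous
lemma chi_cont : Continuous chi := chi_contDiff.continuous

lemma chi_zero {z : ℝ} (h : z ≤ 1) : chi z = 0 :=
  Real.smoothTransition.zero_of_nonpos (by linarith)
lemma chi_one {z : ℝ} (h : 2 ≤ z) : chi z = 1 :=
  Real.smoothTransition.one_of_one_le (by linarith)
lemma chi_nonneg (z : ℝ) : 0 ≤ chi z := Real.smoothTransition.nonneg _
lemma chi_le (z : ℝ) : chi z ≤ 1 := Real.smoothTransition.le_one _

lemma chi1_zero_lt {z : ℝ} (h : z < 1) : chi1 z = 0 := by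
  have : chi =ᶠ[𝓝 z] fun _ => 0 := by
    filter_upwards [Iio_mem_nhds h] with w hw using chi_zero (le_of_lt hw)
  simp [chi1, this.deriv_eq]
lemma chi1_zero_gt {z : ℝ} (h : 2 < z) : chi1 z = 0 := by
  have : chi =ᶠ[𝓝 z] fun _ => 1 := by
    filter_upwards [Ioi_mem_nhds h] with w hw using chi_one (le_of_lt hw)
  simp [chi1, this.deriv_eq]
lemma chi2_zero_lt {z : ℝ} (h : z < 1) : chi2 z = 0 := by
  have : chi1 =ᶠ[𝓝 z] fun _ => 0 := by
    filter_upwards [Iio_mem_nhds h] with w hw using chi1_zero_lt hw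
  simp [chi2, this.deriv_eq]
lemma chi2_zero_gt {z : ℝ} (h : 2 < z) : chi2 z = 0 := by
  have : chi1 =ᶠ[𝓝 z] fun _ => 0 := by
    filter_upwards [Ioi_mem_nhds h] with w hw using chi1_zero_gt hw
  simp [chi2, this.deriv_eq]

lemma chi_bounds : ∃ B : ℝ, 1 ≤ B ∧ ∀ z, |chi1 z| ≤ B ∧ |chi2 z| ≤ B := by
  obtain ⟨B1, h1⟩ := (isCompact_Icc (a := (1:ℝ)) (b := 2)).exists_bound_of_continuousOn chi1_cont.continuousOn
  obtain ⟨B2, h2⟩ := (isCompact_Icc (a := (1:ℝ)) (b := 2)).exists_bound_of_continuousOn chi2_cont.continuousOn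
  refine ⟨max 1 (max B1 B2), le_max_left _ _, fun z => ?_⟩
  have hp : (0:ℝ) ≤ max 1 (max B1 B2) := le_trans zero_le_one (le_max_left _ _)
  rcases lt_or_ge z 1 with h | h
  · rw [chi1_zero_lt h, chi2_zero_lt h]; simp
  rcases lt_or_ge 2 z with h' | h'
  · rw [chi1_zero_gt h', chi2_zero_gt h']; simp
  exact ⟨(h1 z ⟨h, h'⟩).trans ((le_max_left _ _).trans (le_max_right _ _)),
    (h2 z ⟨h, h'⟩).trans ((le_max_right _ _).trans (le_max_right _ _))⟩

lemma chi_integral : ∫ z, (chi1 z + 1 / 2 * (z * chi2 z)) = 1 / 2 := by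
  rw [← intervalIntegral.integral_eq_integral_of_support_subset (a := 0) (b := 3)]
  · rw [intervalIntegral.integral_eq_sub_of_hasDerivAt (f := fun z => 1 / 2 * chi z + 1 / 2 * (z * chi1 z))]
    · rw [chi_one (by norm_num), chi_zero (by norm_num), chi1_zero_gt (by norm_num)]; norm_num
    · intro z _
      exact (((chi_d z).const_mul _).add (((hasDerivAt_id z).mul (chi1_d z)).const_mul _)).congr_deriv
        (by simp; ring)
    · apply Continuous.intervalIntegrable
      have := chi1_cont; have := chi2_cont; fun_prop
  · intro z hz
    by_contra hc
    apply hz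
    rcases lt_or_ge z 1 with h | h
    · simp [chi1_zero_lt h, chi2_zero_lt h]
    rcases lt_or_ge 2 z with h' | h'
    · simp [chi1_zero_gt h', chi2_zero_gt h']
    exact absurd ⟨by linarith, by linarith⟩ hc

namespace IsFBPSol
variable {K v T : ℝ} {π₀ : Measure ℝ} {p pt px pxx : ℝ → ℝ → ℝ} {y y' y'' : ℝ → ℝ}

lemma p_int (H : IsFBPSol K v T π₀ p pt px pxx y y' y'') {t : ℝ} (ht : t ∈ Ioc 0 T) :
    Integrable (p t) := by
  by_contra h
  have := H.p_mass t ht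
  rw [integral_undef h] at this
  norm_num at this

lemma pg_int (H : IsFBPSol K v T π₀ p pt px pxx y y' y'') {t : ℝ} (ht : t ∈ Ioc 0 T) {g : ℝ → ℝ} {C : ℝ}
    (hg : Continuous g) (hC : ∀ x, |g x| ≤ C) : Integrable (fun x => p t x * g x) :=
  (H.p_int ht).mul_bdd (c := C) hg.aestronglyMeasurable (Eventually.of_forall hC)

lemma pg_bound (H : IsFBPSol K v T π₀ p pt px pxx y y' y'') {t : ℝ} (ht : t ∈ Ioc 0 T) {g : ℝ → ℝ} {C : ℝ}
    (hC : ∀ x, |g x| ≤ C) : |∫ x, p t x * g x| ≤ C := by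
  have := norm_integral_le_of_norm_le (f := fun x => p t x * g x) ((H.p_int ht).mul_const C)
    (Eventually.of_forall fun x => by
      rw [norm_mul, Real.norm_eq_abs, abs_of_nonneg (H.p_nonneg t ht x)]
      exact mul_le_mul_of_nonneg_left (hC x) (H.p_nonneg t ht x))
  rw [integral_mul_const, H.p_mass t ht, one_mul] at this
  exact this

lemma pg_tendsto (H : IsFBPSol K v T π₀ p pt px pxx y y' y'') {t : ℝ} (ht : t ∈ Ioc 0 T) {g : ℕ → ℝ → ℝ}
    {g0 : ℝ → ℝ} {C : ℝ} (hg : ∀ n, Continuous (g n))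
    (hC : ∀ n x, |g n x| ≤ C) (hl : ∀ x, y t ≤ x → Tendsto (fun n => g n x) atTop (𝓝 (g0 x))) :
    Tendsto (fun n => ∫ x, p t x * g n x) atTop (𝓝 (∫ x, p t x * g0 x)) := by
  refine tendsto_integral_of_dominated_convergence (fun x => p t x * C) (fun n => ?_)
    ((H.p_int ht).mul_const C) (fun n => Eventually.of_forall fun x => ?_) (Eventually.of_forall fun x => ?_)
  · exact (H.p_int ht).aestronglyMeasurable.mul (hg n).aestronglyMeasurable
  · rw [norm_mul, Real.norm_eq_abs, abs_of_nonneg (H.p_nonneg t ht x)]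
    exact mul_le_mul_of_nonneg_left (hC n x) (H.p_nonneg t ht x)
  · by_cases hx : y t ≤ x
    · exact (hl x hx).const_mul _
    · rw [H.p_support t ht x (not_le.1 hx)]; simp

lemma weak_bdd (H : IsFBPSol K v T π₀ p pt px pxx y y' y'') {a b ε M : ℝ} (ha : 0 < a) (hab : a ≤ b)
    (hb : b ≤ T) (hε : 0 < ε) {ψ ψt ψx ψxx : ℝ → ℝ → ℝ} (hψ : TestFn a b ψ ψt ψx ψxx)
    (cψx : Continuous (fun q : ℝ × ℝ => ψx q.1 q.2))
    (hM : ∀ t ∈ Icc a b, ∀ x, |ψ t x| ≤ M ∧ |ψx t x| ≤ M ∧ |ψt t x + 1 / 2 * ψxx t x| ≤ M)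
    (hs : ∀ t ∈ Icc a b, ∀ x, x < y t + ε → ψ t x = 0 ∧ ψx t x = 0 ∧ ψt t x = 0 ∧ ψxx t x = 0) :
    IntervalIntegrable (fun t => ∫ x, p t x * (ψt t x + 1 / 2 * ψxx t x)) volume a b ∧
    (∫ x, p b x * ψ b x) - (∫ x, p a x * ψ a x) =
      ∫ t in a..b, ∫ x, p t x * (ψt t x + 1 / 2 * ψxx t x) := by
  obtain ⟨B, hB1, hB⟩ := chi_bounds
  have cψ := hψ.c
  have cψt := hψ.ct
  have cψxx := hψ.cxx
  have hIoc : ∀ t ∈ Icc a b, t ∈ Ioc 0 T := fun t ht => ⟨ha.trans_le ht.1, ht.2.trans hb⟩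
  have hM0 : 0 ≤ M := (abs_nonneg _).trans (hM a ⟨le_rfl, hab⟩ 0).1
  set r : ℕ → ℝ := fun n => ((n : ℝ) + 1)⁻¹ with hr
  have hrpos : ∀ n, 0 < r n := fun n => by positivity
  have hr1 : ∀ n, r n ≤ 1 := fun n => by
    apply inv_le_one_of_one_le₀; linarith [(Nat.cast_nonneg n : (0:ℝ) ≤ n)]
  have c0 := chi_cont
  have c1 := chi1_cont
  have c2 := chi2_cont
  set P : ℕ → ℝ → ℝ → ℝ := fun n t x => ψ t x * (1 - chi (x * r n)) with hP
  set Px : ℕ → ℝ → ℝ → ℝ := fun n t x => ψx t x * (1 - chi (x * r n)) + ψ t x * (-(chi1 (x * r n) * r n)) with hPx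
  set Pxx : ℕ → ℝ → ℝ → ℝ := fun n t x => (ψxx t x * (1 - chi (x * r n)) + ψx t x * (-(chi1 (x * r n) * r n))) +
    (ψx t x * (-(chi1 (x * r n) * r n)) + ψ t x * (-(chi2 (x * r n) * r n * r n))) with hPxx
  set Pt : ℕ → ℝ → ℝ → ℝ := fun n t x => ψt t x * (1 - chi (x * r n)) with hPt
  have dχ : ∀ n x, HasDerivAt (fun x => 1 - chi (x * r n)) (-(chi1 (x * r n) * r n)) x := by
    intro n x
    have h : HasDerivAt (fun x => x * r n) (r n) x := by simpa using (hasDerivAt_id x).mul_const (r n)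
    exact ((chi_d _).comp x h).const_sub 1
  have dχ1 : ∀ n x, HasDerivAt (fun x => -(chi1 (x * r n) * r n)) (-(chi2 (x * r n) * r n * r n)) x := by
    intro n x
    have h : HasDerivAt (fun x => x * r n) (r n) x := by simpa using (hasDerivAt_id x).mul_const (r n)
    exact (((chi1_d _).comp x h).mul_const (r n)).neg
  have hT : ∀ n, TestFn a b (P n) (Pt n) (Px n) (Pxx n) := by
    intro n
    refine ⟨fun t ht x => (hψ.dt t ht x).mul_const _, fun t ht x => (hψ.dx t ht x).mul (dχ n x),
      fun t ht x => ((hψ.dxx t ht x).mul (dχ n x)).add ((hψ.dx t ht x).mul (dχ1 n x)), ?_, ?_, ?_⟩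
    · simp only [hP]; fun_prop
    · simp only [hPt]; fun_prop
    · simp only [hPxx]; fun_prop
  have key := fun n : ℕ => H.weak_cpt ha hab hb hε (R := 2 * (n + 1)) (hT n) (by
    intro t ht x hx
    rcases lt_or_ge x (y t + ε) with h | h
    · obtain ⟨h1, h2, h3, h4⟩ := hs t ht x h
      simp [hP, hPx, hPxx, hPt, h1, h2, h3, h4]
    · have hx2 : 2 * ((n : ℝ) + 1) < x := by
        by_contra hc; exact hx ⟨h, not_lt.1 hc⟩
      have hx3 : 2 < x * r n := by
        rw [hr]; simp only; rw [← div_eq_mul_inv, lt_div_iff₀ (by positivity)]; exact hx2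
      simp [hP, hPx, hPxx, hPt, chi_one hx3.le, chi1_zero_gt hx3, chi2_zero_gt hx3])
  have hLn : ∀ n t x, Pt n t x + 1 / 2 * Pxx n t x = (ψt t x + 1 / 2 * ψxx t x) * (1 - chi (x * r n)) +
      (ψx t x * (-(chi1 (x * r n) * r n)) + 1 / 2 * (ψ t x * (-(chi2 (x * r n) * r n * r n)))) := by
    intro n t x; simp only [hPt, hPxx]; ring
  have hχb : ∀ n x, |1 - chi (x * r n)| ≤ 1 := by
    intro n x; rw [abs_le]; constructor <;> linarith [chi_nonneg (x * r n), chi_le (x * r n)]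
  have hb1 : ∀ n x, |-(chi1 (x * r n) * r n)| ≤ B := by
    intro n x; rw [abs_neg, abs_mul, abs_of_pos (hrpos n)]
    nlinarith [(hB (x * r n)).1, hr1 n, hrpos n, abs_nonneg (chi1 (x * r n))]
  have hb2 : ∀ n x, |-(chi2 (x * r n) * r n * r n)| ≤ B := by
    intro n x; rw [abs_neg, abs_mul, abs_mul, abs_of_pos (hrpos n)]
    have : |chi2 (x * r n)| * r n ≤ B := by
      nlinarith [(hB (x * r n)).2, hr1 n, hrpos n, abs_nonneg (chi2 (x * r n))]
    nlinarith [hr1 n, hrpos n, mul_nonneg (abs_nonneg (chi2 (x * r n))) (hrpos n).le]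
  set C := M + (M * B + 1 / 2 * (M * B)) with hC
  have hLb : ∀ n, ∀ t ∈ Icc a b, ∀ x, |Pt n t x + 1 / 2 * Pxx n t x| ≤ C := by
    intro n t ht x
    obtain ⟨h1, h2, h3⟩ := hM t ht x
    rw [hLn]
    refine (abs_add_le _ _).trans (add_le_add ?_ ((abs_add_le _ _).trans (add_le_add ?_ ?_)))
    · rw [abs_mul]; simpa using mul_le_mul h3 (hχb n x) (abs_nonneg _) hM0
    · rw [abs_mul]; exact mul_le_mul h2 (hb1 n x) (abs_nonneg _) hM0
    · rw [abs_mul, abs_mul, abs_of_pos (by norm_num : (0:ℝ) < 1 / 2)]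
      exact mul_le_mul_of_nonneg_left (mul_le_mul h1 (hb2 n x) (abs_nonneg _) hM0) (by norm_num)
  have hev : ∀ x, ∀ᶠ n in atTop, x * r n < 1 := by
    intro x
    obtain ⟨N, hN⟩ := exists_nat_gt x
    filter_upwards [eventually_ge_atTop N] with n hn
    rw [hr]; simp only; rw [← div_eq_mul_inv, div_lt_one (by positivity)]
    have : (N : ℝ) ≤ n := by exact_mod_cast hn
    linarith
  have hlim : ∀ t ∈ Icc a b, Tendsto (fun n => ∫ x, p t x * (Pt n t x + 1 / 2 * Pxx n t x)) atTop
      (𝓝 (∫ x, p t x * (ψt t x + 1 / 2 * ψxx t x))) := by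
    intro t ht
    refine H.pg_tendsto (hIoc t ht) (C := C) (fun n => ?_) (fun n x => hLb n t ht x) (fun x _ => ?_)
    · exact cont_fix (f := fun t x => Pt n t x + 1 / 2 * Pxx n t x)
        ((hT n).ct.add ((hT n).cxx.const_mul _)) t
    · refine tendsto_const_nhds.congr' ?_
      filter_upwards [hev x] with n hn
      rw [hLn, chi_zero hn.le, chi1_zero_lt hn, chi2_zero_lt hn]; ring
  have hlim2 : ∀ t ∈ Icc a b, Tendsto (fun n => ∫ x, p t x * P n t x) atTop (𝓝 (∫ x, p t x * ψ t x)) := by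
    intro t ht
    refine H.pg_tendsto (hIoc t ht) (C := M) (fun n => cont_fix (hT n).c t) (fun n x => ?_) (fun x _ => ?_)
    · simp only [hP, abs_mul]
      simpa using mul_le_mul (hM t ht x).1 (hχb n x) (abs_nonneg _) hM0
    · refine tendsto_const_nhds.congr' ?_
      filter_upwards [hev x] with n hn
      simp only [hP]; rw [chi_zero hn.le]; ring
  have hout : Tendsto (fun n => ∫ t in a..b, ∫ x, p t x * (Pt n t x + 1 / 2 * Pxx n t x)) atTop
      (𝓝 (∫ t in a..b, ∫ x, p t x * (ψt t x + 1 / 2 * ψxx t x))) := by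
    refine intervalIntegral.tendsto_integral_filter_of_dominated_convergence (fun _ => C)
      (Eventually.of_forall fun n => ?_) (Eventually.of_forall fun n => Eventually.of_forall fun t ht => ?_)
      intervalIntegrable_const (Eventually.of_forall fun t ht => ?_)
    · rw [uIoc_of_le hab]; exact (key n).1.1.aestronglyMeasurable
    · rw [uIoc_of_le hab] at ht
      exact H.pg_bound (hIoc t ⟨ht.1.le, ht.2⟩) (hLb n t ⟨ht.1.le, ht.2⟩)
    · rw [uIoc_of_le hab] at ht
      exact hlim t ⟨ht.1.le, ht.2⟩
  constructor
  · rw [intervalIntegrable_iff_integrableOn_Ioc_of_le hab]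
    refine Integrable.of_bound (C := C) ?_ ?_
    · exact aestronglyMeasurable_of_tendsto_ae atTop (fun n => (key n).1.1.aestronglyMeasurable)
        ((ae_restrict_iff' measurableSet_Ioc).2 (Eventually.of_forall fun t ht => hlim t ⟨ht.1.le, ht.2⟩))
    · refine (ae_restrict_iff' measurableSet_Ioc).2 (Eventually.of_forall fun t ht => ?_)
      refine H.pg_bound (hIoc t ⟨ht.1.le, ht.2⟩) fun x => ((hM t ⟨ht.1.le, ht.2⟩ x).2.2).trans ?_
      rw [hC]; nlinarith
  · refine tendsto_nhds_unique (((hlim2 b ⟨hab, le_rfl⟩).sub (hlim2 a ⟨le_rfl, hab⟩)).congr fun n => ?_) hout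
    rw [← (key n).2]
    simp only [mul_comm]

end IsFBPSol

namespace IsFBPSol
variable {K v T : ℝ} {π₀ : Measure ℝ} {p pt px pxx : ℝ → ℝ → ℝ} {y y' y'' : ℝ → ℝ}

lemma q_exists (H : IsFBPSol K v T π₀ p pt px pxx y y' y'') {a b : ℝ} (ha : 0 < a) (hab : a ≤ b)
    (hb : b ≤ T) : ∃ q : ℝ → ℝ → ℝ, Continuous (fun r : ℝ × ℝ => q r.1 r.2) ∧
      ∀ t ∈ Icc a b, ∀ x, y t ≤ x → q t x = p t x := by
  have hyc : ContinuousOn y (Icc a b) := H.y_cont.mono (Icc_subset_Icc ha.le hb)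
  refine ⟨fun t x => p (cl a b t) (max x (y (cl a b t))), ?_, ?_⟩
  · have hy2 := comp_cl hab hyc
    have : Continuous (fun r : ℝ × ℝ => ((cl a b r.1, max r.2 (y (cl a b r.1))) : ℝ × ℝ)) := by
      have h1 : Continuous (fun r : ℝ × ℝ => cl a b r.1) := (cl_cont a b).comp continuous_fst
      have h2 : Continuous (fun r : ℝ × ℝ => y (cl a b r.1)) := hy2.comp continuous_fst
      exact h1.prodMk (continuous_snd.max h2)
    refine H.p_cont.comp_continuous this ?_
    intro r
    have := cl_mem hab r.1
    exact ⟨⟨ha.trans_le this.1, this.2.trans hb⟩, le_max_right _ _⟩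
  · intro t ht x hx
    simp only [cl_eq ht, max_eq_left hx]

lemma weak_bdry (H : IsFBPSol K v T π₀ p pt px pxx y y' y'') {a b M : ℝ} (ha : 0 < a) (hab : a ≤ b)
    (hb : b ≤ T) {φ φt φx φxx : ℝ → ℝ → ℝ} (hφ : TestFn a b φ φt φx φxx)
    (cφx : Continuous (fun q : ℝ × ℝ => φx q.1 q.2))
    (hM : ∀ t ∈ Icc a b, ∀ x, |φ t x| ≤ M ∧ |φx t x| ≤ M)
    (hcal : ∀ t ∈ Icc a b, ∀ x, φt t x = - (1 / 2 * φxx t x))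
    {Y Y' m' : ℝ → ℝ} (cY : Continuous Y) (cY' : Continuous Y') (cm' : Continuous m')
    (dY : ∀ t ∈ Icc a b, HasDerivWithinAt Y (Y' t) (Icc a b) t)
    (dm : ∀ t ∈ Icc a b, HasDerivWithinAt (fun t => φ t (Y t)) (m' t) (Icc a b) t)
    (hY : ∀ t ∈ Icc a b, Y t = y t) :
    (∫ x, p b x * φ b x) - (∫ x, p a x * φ a x) =
      1 / 2 * ∫ t in a..b, φx t (y t) * p t (y t) := by
  obtain ⟨B, hB1, hB⟩ := chi_bounds
  have cφ := hφ.c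
  have cφt := hφ.ct
  have cφxx := hφ.cxx
  have hIoc : ∀ t ∈ Icc a b, t ∈ Ioc 0 T := fun t ht => ⟨ha.trans_le ht.1, ht.2.trans hb⟩
  have hma : a ∈ Icc a b := ⟨le_rfl, hab⟩
  have hmb : b ∈ Icc a b := ⟨hab, le_rfl⟩
  have hM0 : 0 ≤ M := (abs_nonneg _).trans (hM a hma 0).1
  obtain ⟨q, cq, hq⟩ := H.q_exists ha hab hb
  obtain ⟨D1, hD1⟩ := (isCompact_Icc (a := a) (b := b)).exists_bound_of_continuousOn cY'.continuousOn
  obtain ⟨D2, hD2⟩ := (isCompact_Icc (a := a) (b := b)).exists_bound_of_continuousOn cm'.continuousOn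
  have hD10 : 0 ≤ D1 := (abs_nonneg _).trans (hD1 a hma)
  have hD20 : 0 ≤ D2 := (abs_nonneg _).trans (hD2 a hma)
  have cqY : Continuous (fun r : ℝ × ℝ => q r.1 (Y r.1 + r.2)) :=
    cq.comp (continuous_fst.prodMk ((cY.comp continuous_fst).add continuous_snd))
  obtain ⟨Q, hQ⟩ := ((isCompact_Icc (a := a) (b := b)).prod
    (isCompact_Icc (a := (0:ℝ)) (b := 2))).exists_bound_of_continuousOn cqY.continuousOn
  have hQ0 : 0 ≤ Q := (abs_nonneg _).trans (hQ (a, 0) ⟨hma, by simp⟩)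
  set N : ℕ → ℝ := fun n => (n : ℝ) + 1 with hN
  have hNpos : ∀ n, 0 < N n := fun n => by positivity
  have hN1 : ∀ n, 1 ≤ N n := fun n => by
    simp only [hN]; linarith [(Nat.cast_nonneg n : (0:ℝ) ≤ n)]
  have c0 := chi_cont
  have c1 := chi1_cont
  have c2 := chi2_cont
  have cφY : Continuous (fun t => φ t (Y t)) := cφ.comp (continuous_id.prodMk cY)
  set m : ℝ → ℝ := fun t => φ t (Y t) with hm
  set θ : ℝ → ℝ → ℝ := fun t x => φ t x - m t with hθ
  have cθ : Continuous (fun r : ℝ × ℝ => θ r.1 r.2) := cφ.sub (cφY.comp continuous_fst)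
  have hθb : ∀ t ∈ Icc a b, ∀ x, |θ t x| ≤ 2 * M := by
    intro t ht x
    have h1 := abs_le.1 (hM t ht x).1
    have h2 := abs_le.1 (hM t ht (Y t)).1
    simp only [hθ, hm]; rw [abs_le]; constructor <;> linarith
  have hθL : ∀ t ∈ Icc a b, ∀ w, |θ t (Y t + w)| ≤ M * |w| := by
    intro t ht w
    have := Convex.norm_image_sub_le_of_norm_hasDerivWithin_le (f := φ t) (f' := φx t) (s := univ) (C := M)
      (x := Y t) (y := Y t + w) (fun x _ => (hφ.dx t ht x).hasDerivWithinAt) (fun x _ => (hM t ht x).2)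
      convex_univ (mem_univ _) (mem_univ _)
    simpa [hθ, hm] using this
  set X0 : ℕ → ℝ → ℝ → ℝ := fun n t x => chi (N n * (x - Y t)) with hX0
  set X1 : ℕ → ℝ → ℝ → ℝ := fun n t x => chi1 (N n * (x - Y t)) with hX1
  set X2 : ℕ → ℝ → ℝ → ℝ := fun n t x => chi2 (N n * (x - Y t)) with hX2
  have cX0 : ∀ n, Continuous (fun r : ℝ × ℝ => X0 n r.1 r.2) := by intro n; simp only [hX0]; fun_prop
  have cX1 : ∀ n, Continuous (fun r : ℝ × ℝ => X1 n r.1 r.2) := by intro n; simp only [hX1]; fun_prop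
  have cX2 : ∀ n, Continuous (fun r : ℝ × ℝ => X2 n r.1 r.2) := by intro n; simp only [hX2]; fun_prop
  set P : ℕ → ℝ → ℝ → ℝ := fun n t x => θ t x * X0 n t x with hP
  set Px : ℕ → ℝ → ℝ → ℝ := fun n t x => φx t x * X0 n t x + θ t x * (X1 n t x * N n) with hPx
  set Pxx : ℕ → ℝ → ℝ → ℝ := fun n t x => (φxx t x * X0 n t x + φx t x * (X1 n t x * N n)) +
    (φx t x * (X1 n t x * N n) + θ t x * (X2 n t x * N n * N n)) with hPxx
  set Pt : ℕ → ℝ → ℝ → ℝ := fun n t x => (φt t x - m' t) * X0 n t x + θ t x * (X1 n t x * (N n * (- Y' t))) with hPt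
  have dlin : ∀ n t x, HasDerivAt (fun x => N n * (x - Y t)) (N n) x := by
    intro n t x
    simpa using ((hasDerivAt_id x).sub_const (Y t)).const_mul (N n)
  have dX0 : ∀ n t x, HasDerivAt (X0 n t) (X1 n t x * N n) x := by
    intro n t x
    exact (chi_d _).comp x (dlin n t x)
  have dX1 : ∀ n t x, HasDerivAt (fun x => X1 n t x * N n) (X2 n t x * N n * N n) x := by
    intro n t x
    exact ((chi1_d _).comp x (dlin n t x)).mul_const (N n)
  have dθ : ∀ t ∈ Icc a b, ∀ x, HasDerivAt (θ t) (φx t x) x := fun t ht x =>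
    (hφ.dx t ht x).sub_const _
  have hT : ∀ n, TestFn a b (P n) (Pt n) (Px n) (Pxx n) := by
    intro n
    refine ⟨fun t ht x => ?_, fun t ht x => (dθ t ht x).mul (dX0 n t x),
      fun t ht x => ((hφ.dxx t ht x).mul (dX0 n t x)).add ((dθ t ht x).mul (dX1 n t x)), ?_, ?_, ?_⟩
    · have h1 : HasDerivWithinAt (fun s => N n * (x - Y s)) (N n * (- Y' t)) (Icc a b) t :=
        ((dY t ht).const_sub x).const_mul (N n)
      exact ((hφ.dt t ht x).sub (dm t ht)).mul ((chi_d _).comp_hasDerivWithinAt t h1)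
    · exact cθ.mul (cX0 n)
    · have := cX0 n; have := cX1 n
      simp only [hPt]; fun_prop
    · have := cX0 n; have := cX1 n; have := cX2 n
      simp only [hPxx]; fun_prop
  have cPx : ∀ n, Continuous (fun r : ℝ × ℝ => Px n r.1 r.2) := by
    intro n; have := cX0 n; have := cX1 n
    simp only [hPx]; fun_prop
  set S : ℕ → ℝ → ℝ → ℝ := fun n t x => N n * (X1 n t x * (φx t x - θ t x * Y' t) + 1 / 2 * (N n * θ t x) * X2 n t x) with hS
  have hLn : ∀ n, ∀ t ∈ Icc a b, ∀ x, Pt n t x + 1 / 2 * Pxx n t x = (- m' t) * X0 n t x + S n t x := by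
    intro n t ht x
    simp only [hPt, hPxx, hS]; rw [hcal t ht x]; ring
  have hX0b : ∀ n t x, |X0 n t x| ≤ 1 := fun n t x => by
    rw [abs_of_nonneg (chi_nonneg _)]; exact chi_le _
  have hX1b : ∀ n t x, |X1 n t x| ≤ B := fun n t x => (hB _).1
  have hX2b : ∀ n t x, |X2 n t x| ≤ B := fun n t x => (hB _).2
  have hm'X : ∀ n, ∀ t ∈ Icc a b, ∀ x, |(- m' t) * X0 n t x| ≤ D2 := by
    intro n t ht x
    rw [abs_mul, abs_neg]
    simpa using mul_le_mul (hD2 t ht) (hX0b n t x) (abs_nonneg _) hD20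
  have hφθ : ∀ t ∈ Icc a b, ∀ x, |φx t x - θ t x * Y' t| ≤ M + 2 * M * D1 := by
    intro t ht x
    refine (abs_sub _ _).trans (add_le_add (hM t ht x).2 ?_)
    rw [abs_mul]; exact mul_le_mul (hθb t ht x) (hD1 t ht) (abs_nonneg _) (by positivity)
  have hSb : ∀ n, ∀ t ∈ Icc a b, ∀ x, |S n t x| ≤ N n * (B * (M + 2 * M * D1) + 1 / 2 * (N n * (2 * M)) * B) := by
    intro n t ht x
    simp only [hS]; rw [abs_mul, abs_of_pos (hNpos n)]
    refine mul_le_mul_of_nonneg_left ((abs_add_le _ _).trans (add_le_add ?_ ?_)) (hNpos n).le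
    · rw [abs_mul]; exact mul_le_mul (hX1b n t x) (hφθ t ht x) (abs_nonneg _) (by linarith)
    · rw [abs_mul, abs_mul, abs_mul, abs_of_pos (hNpos n), abs_of_pos (by norm_num : (0:ℝ) < 1 / 2)]
      have := hNpos n
      refine mul_le_mul (mul_le_mul_of_nonneg_left (mul_le_mul_of_nonneg_left (hθb t ht x) this.le) (by norm_num))
        (hX2b n t x) (abs_nonneg _) (by positivity)
  have cS : ∀ n t, Continuous (S n t) := by
    intro n t
    have h1 := cont_fix (cX1 n) t; have h2 := cont_fix (cX2 n) t; have h3 := cont_fix cθ t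
    have h4 := cont_fix cφx t
    simp only [hS]; fun_prop
  have key := fun n : ℕ => H.weak_bdd (ε := (N n)⁻¹)
    (M := 2 * M + (M + 2 * M * (B * N n)) + (D2 + N n * (B * (M + 2 * M * D1) + 1 / 2 * (N n * (2 * M)) * B)))
    ha hab hb (inv_pos.2 (hNpos n)) (hT n) (cPx n) (by
    intro t ht x
    have hn := hNpos n
    have e1 : |P n t x| ≤ 2 * M := by
      simp only [hP, abs_mul]
      simpa using mul_le_mul (hθb t ht x) (hX0b n t x) (abs_nonneg _) (by positivity)
    have e2 : |Px n t x| ≤ M + 2 * M * (B * N n) := by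
      simp only [hPx]
      refine (abs_add_le _ _).trans (add_le_add ?_ ?_)
      · rw [abs_mul]; simpa using mul_le_mul (hM t ht x).2 (hX0b n t x) (abs_nonneg _) hM0
      · rw [abs_mul, abs_mul, abs_of_pos hn]
        exact mul_le_mul (hθb t ht x) (mul_le_mul_of_nonneg_right (hX1b n t x) hn.le) (by positivity) (by positivity)
    have e3 : |Pt n t x + 1 / 2 * Pxx n t x| ≤ D2 + N n * (B * (M + 2 * M * D1) + 1 / 2 * (N n * (2 * M)) * B) := by
      rw [hLn n t ht x]
      exact (abs_add_le _ _).trans (add_le_add (hm'X n t ht x) (hSb n t ht x))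
    have p1 : 0 ≤ 2 * M := by positivity
    have p2 := (abs_nonneg _).trans e2
    have p3 := (abs_nonneg _).trans e3
    exact ⟨by linarith, by linarith, by linarith⟩) (by
    intro t ht x hx
    have hn := hNpos n
    have hlt : N n * (x - Y t) < 1 := by
      rw [hY t ht]
      have : x - y t < (N n)⁻¹ := by linarith
      calc N n * (x - y t) < N n * (N n)⁻¹ := mul_lt_mul_of_pos_left this hn
        _ = 1 := mul_inv_cancel₀ hn.ne'
    have z0 : X0 n t x = 0 := chi_zero hlt.le
    have z1 : X1 n t x = 0 := chi1_zero_lt hlt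
    have z2 : X2 n t x = 0 := chi2_zero_lt hlt
    simp [hP, hPx, hPxx, hPt, z0, z1, z2])
  -- substitution
  set h : ℕ → ℝ → ℝ → ℝ := fun n t z => q t (Y t + z * (N n)⁻¹) *
    (chi1 z * (φx t (Y t + z * (N n)⁻¹) - θ t (Y t + z * (N n)⁻¹) * Y' t) +
      1 / 2 * (N n * θ t (Y t + z * (N n)⁻¹)) * chi2 z) with hh
  have hsub : ∀ n, ∀ t ∈ Icc a b, ∫ x, p t x * S n t x = ∫ z, h n t z := by
    intro n t ht
    have hn := hNpos n
    have e : ∀ x, p t x * S n t x = N n * h n t (N n * (x - Y t)) := by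
      intro x
      have ex : Y t + N n * (x - Y t) * (N n)⁻¹ = x := by field_simp; ring
      simp only [hh, ex, hS]
      by_cases hx : y t ≤ x
      · rw [hq t ht x hx]; ring
      · have : N n * (x - Y t) < 1 := by
          rw [hY t ht]; nlinarith
        simp only [hX1, hX2]
        rw [chi1_zero_lt this, chi2_zero_lt this]; ring
    simp_rw [e]
    rw [integral_const_mul, integral_sub_right_eq_self (fun x => h n t (N n * x)),
      Measure.integral_comp_mul_left (h n t), abs_of_pos (inv_pos.2 hn), smul_eq_mul, ← mul_assoc,
      mul_inv_cancel₀ hn.ne', one_mul]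
  set E := Q * (B * (M + 2 * M * D1) + M * B * 2 ) with hE
  have hE0 : 0 ≤ E := by positivity
  have hhb : ∀ n, ∀ t ∈ Icc a b, ∀ z, |h n t z| ≤ (Icc (1:ℝ) 2).indicator (fun _ => E) z := by
    intro n t ht z
    have hn := hNpos n
    rcases lt_or_ge z 1 with h1 | h1
    · simp only [hh]; rw [chi1_zero_lt h1, chi2_zero_lt h1]
      simp [indicator_nonneg, hE0]
    rcases lt_or_ge 2 z with h2 | h2
    · simp only [hh]; rw [chi1_zero_gt h2, chi2_zero_gt h2]
      simp [indicator_nonneg, hE0]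
    rw [indicator_of_mem (show z ∈ Icc (1:ℝ) 2 from ⟨h1, h2⟩)]
    have hi1 : (N n)⁻¹ ≤ 1 := inv_le_one_of_one_le₀ (hN1 n)
    have hi0 : 0 < (N n)⁻¹ := inv_pos.2 hn
    have hz0 : 0 ≤ z * (N n)⁻¹ := by positivity
    simp only [hh]; rw [abs_mul]
    refine mul_le_mul (hQ (t, z * (N n)⁻¹) ⟨ht, hz0, by nlinarith⟩) ?_ (abs_nonneg _) hQ0
    refine (abs_add_le _ _).trans (add_le_add ?_ ?_)
    · rw [abs_mul]; exact mul_le_mul (hB z).1 (hφθ t ht _) (abs_nonneg _) (by linarith)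
    · rw [abs_mul, abs_mul, abs_mul, abs_of_pos hn, abs_of_pos (by norm_num : (0:ℝ) < 1 / 2)]
      have h3 := hθL t ht (z * (N n)⁻¹)
      rw [abs_of_nonneg hz0] at h3
      have h4 : N n * |θ t (Y t + z * (N n)⁻¹)| ≤ M * 2 := by
        calc N n * |θ t (Y t + z * (N n)⁻¹)| ≤ N n * (M * (z * (N n)⁻¹)) := mul_le_mul_of_nonneg_left h3 hn.le
          _ = M * z := by field_simp
          _ ≤ M * 2 := mul_le_mul_of_nonneg_left h2 hM0
      have h5 := (hB z).2
      have h6 : 0 ≤ N n * |θ t (Y t + z * (N n)⁻¹)| := by positivity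
      calc 1 / 2 * (N n * |θ t (Y t + z * (N n)⁻¹)|) * |chi2 z| ≤ 1 / 2 * (M * 2) * B := by gcongr
        _ ≤ M * B * 2 := by nlinarith [mul_nonneg hM0 (zero_le_one.trans hB1)]
  have hind : Integrable ((Icc (1:ℝ) 2).indicator (fun _ => E)) := by
    rw [integrable_indicator_iff measurableSet_Icc]
    exact integrableOn_const (by simp)
  have hind_val : ∫ z, (Icc (1:ℝ) 2).indicator (fun _ => E) z = E := by
    rw [integral_indicator measurableSet_Icc]; simp; norm_num
  have hw0 : Tendsto (fun n => (N n)⁻¹) atTop (𝓝[≠] 0) := by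
    refine tendsto_nhdsWithin_iff.2 ⟨?_, Eventually.of_forall fun n => (inv_pos.2 (hNpos n)).ne'⟩
    simpa [hN] using tendsto_one_div_add_atTop_nhds_zero_nat (𝕜 := ℝ)
  have hhlim : ∀ t ∈ Icc a b, Tendsto (fun n => ∫ z, h n t z) atTop
      (𝓝 (1 / 2 * (φx t (y t) * p t (y t)))) := by
    intro t ht
    have e0 : 1 / 2 * (φx t (y t) * p t (y t)) = ∫ z, q t (Y t) * (chi1 z * (φx t (Y t) - 0 * Y' t) + 1 / 2 * (φx t (Y t) * z) * chi2 z) := by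
      have : ∀ z, q t (Y t) * (chi1 z * (φx t (Y t) - 0 * Y' t) + 1 / 2 * (φx t (Y t) * z) * chi2 z) =
          (q t (Y t) * φx t (Y t)) * (chi1 z + 1 / 2 * (z * chi2 z)) := fun z => by ring
      simp_rw [this]
      rw [integral_const_mul, chi_integral, hY t ht, hq t ht _ le_rfl]; ring
    rw [e0]
    have cqt := cont_fix cq t
    have cθt := cont_fix cθ t
    have cφxt := cont_fix cφx t
    refine tendsto_integral_of_dominated_convergence _ (fun n => ?_) hind
      (fun n => Eventually.of_forall fun z => hhb n t ht z) (Eventually.of_forall fun z => ?_)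
    · apply Continuous.aestronglyMeasurable
      simp only [hh]; fun_prop
    · have harg : Tendsto (fun n => Y t + z * (N n)⁻¹) atTop (𝓝 (Y t)) := by
        simpa using ((hw0.mono_right nhdsWithin_le_nhds).const_mul z).const_add (Y t)
      have hθ0 : θ t (Y t) = 0 := by simp [hθ, hm]
      have t1 : Tendsto (fun n => θ t (Y t + z * (N n)⁻¹)) atTop (𝓝 0) := by
        have := (cθt.tendsto (Y t)).comp harg
        rwa [hθ0] at this
      have t2 : Tendsto (fun n => N n * θ t (Y t + z * (N n)⁻¹)) atTop (𝓝 (φx t (Y t) * z)) := by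
        have hd : HasDerivAt (fun w => θ t (Y t + z * w)) (φx t (Y t) * z) 0 := by
          have hl : HasDerivAt (fun w => Y t + z * w) z 0 := by
            simpa using ((hasDerivAt_id (0:ℝ)).const_mul z).const_add (Y t)
          have hd' : HasDerivAt (θ t) (φx t (Y t)) (Y t + z * 0) := by
            rw [mul_zero, add_zero]; exact dθ t ht (Y t)
          exact hd'.comp 0 hl
        have := (hasDerivAt_iff_tendsto_slope_zero.1 hd).comp hw0
        refine this.congr fun n => ?_
        simp [hθ0]
      exact ((cqt.tendsto _).comp harg).mul ((((((cφxt.tendsto _).comp harg).sub (t1.mul_const _))).const_mul _).add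
        ((t2.const_mul _).mul_const _))
  have hF : ∀ n, ∀ t ∈ Icc a b, ∫ x, p t x * (Pt n t x + 1 / 2 * Pxx n t x) =
      (∫ x, p t x * ((- m' t) * X0 n t x)) + ∫ z, h n t z := by
    intro n t ht
    have e : ∀ x, p t x * (Pt n t x + 1 / 2 * Pxx n t x) = p t x * ((- m' t) * X0 n t x) + p t x * S n t x := by
      intro x; rw [hLn n t ht x]; ring
    simp_rw [e]
    rw [integral_add, hsub n t ht]
    · exact H.pg_int (hIoc t ht) (((cont_fix (cX0 n) t)).const_mul _) (hm'X n t ht)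
    · exact H.pg_int (hIoc t ht) (cS n t) (hSb n t ht)
  have hX0lim : ∀ t ∈ Icc a b, ∀ x, y t < x → Tendsto (fun n => X0 n t x) atTop (𝓝 1) := by
    intro t ht x hx
    refine tendsto_const_nhds.congr' ?_
    obtain ⟨k, hk⟩ := exists_nat_gt (2 / (x - y t))
    filter_upwards [eventually_ge_atTop k] with n hn
    simp only [hX0]
    refine (chi_one ?_).symm
    have h1 : (k : ℝ) ≤ n := by exact_mod_cast hn
    have h2 : 0 < x - y t := by linarith
    rw [div_lt_iff₀ h2] at hk
    rw [hY t ht]; simp only [hN]; nlinarith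
  have hmass : ∀ t ∈ Icc a b, Tendsto (fun n => ∫ x, p t x * ((- m' t) * X0 n t x)) atTop (𝓝 (- m' t)) := by
    intro t ht
    have e : - m' t = ∫ x, p t x * ((- m' t) * (Ioi (y t)).indicator (fun _ => 1) x) := by
      have e2 : (fun x => p t x * ((- m' t) * (Ioi (y t)).indicator (fun _ => (1:ℝ)) x)) =ᵐ[volume]
          fun x => p t x * (- m' t) := by
        filter_upwards [compl_mem_ae_iff.2 (measure_singleton (μ := volume) (y t))] with x hx
        rcases lt_trichotomy x (y t) with hlt | heq | hgt
        · rw [H.p_support t (hIoc t ht) x hlt]; simp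
        · exact absurd heq hx
        · rw [indicator_of_mem (show x ∈ Ioi (y t) from hgt), mul_one]
      rw [integral_congr_ae e2, integral_mul_const, H.p_mass t (hIoc t ht), one_mul]
    have : Tendsto (fun n => ∫ x, p t x * ((- m' t) * X0 n t x)) atTop
        (𝓝 (∫ x, p t x * ((- m' t) * (Ioi (y t)).indicator (fun _ => 1) x))) := by
      refine H.pg_tendsto (hIoc t ht) (fun n => (cont_fix (cX0 n) t).const_mul _) (fun n => hm'X n t ht)
        (fun x hx => Tendsto.const_mul _ ?_)
      rcases hx.eq_or_lt with heq | hlt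
      · rw [← heq]; simp [hX0, hY t ht, chi_zero]
      · rw [indicator_of_mem (show x ∈ Ioi (y t) from hlt)]; exact hX0lim t ht x hlt
    rwa [← e] at this
  have hleft : ∀ t ∈ Icc a b, Tendsto (fun n => ∫ x, p t x * P n t x) atTop (𝓝 ((∫ x, p t x * φ t x) - m t)) := by
    intro t ht
    have e : (∫ x, p t x * φ t x) - m t = ∫ x, p t x * θ t x := by
      simp only [hθ, mul_sub]
      rw [integral_sub (H.pg_int (hIoc t ht) (cont_fix cφ t) (fun x => (hM t ht x).1)) ((H.p_int (hIoc t ht)).mul_const _),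
        integral_mul_const, H.p_mass t (hIoc t ht), one_mul]
    rw [e]
    refine H.pg_tendsto (hIoc t ht) (C := 2 * M) (fun n => cont_fix (hT n).c t) (fun n x => ?_) (fun x hx => ?_)
    · simp only [hP, abs_mul]
      simpa using mul_le_mul (hθb t ht x) (hX0b n t x) (abs_nonneg _) (by positivity)
    · simp only [hP]
      rcases hx.eq_or_lt with heq | hlt
      · have : θ t x = 0 := by simp [hθ, hm, ← heq, hY t ht]
        simp [this]
      · simpa using (hX0lim t ht x hlt).const_mul (θ t x)
  have hout : Tendsto (fun n => ∫ t in a..b, ∫ x, p t x * (Pt n t x + 1 / 2 * Pxx n t x)) atTop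
      (𝓝 (∫ t in a..b, (- m' t + 1 / 2 * (φx t (y t) * p t (y t))))) := by
    refine intervalIntegral.tendsto_integral_filter_of_dominated_convergence (fun _ => D2 + E)
      (Eventually.of_forall fun n => ?_) (Eventually.of_forall fun n => Eventually.of_forall fun t ht => ?_)
      intervalIntegrable_const (Eventually.of_forall fun t ht => ?_)
    · rw [uIoc_of_le hab]; exact (key n).1.1.aestronglyMeasurable
    · rw [uIoc_of_le hab] at ht
      have ht' : t ∈ Icc a b := ⟨ht.1.le, ht.2⟩
      rw [hF n t ht']
      refine (norm_add_le _ _).trans (add_le_add (H.pg_bound (hIoc t ht') (hm'X n t ht')) ?_)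
      rw [← hind_val]
      exact norm_integral_le_of_norm_le hind (Eventually.of_forall fun z => hhb n t ht' z)
    · rw [uIoc_of_le hab] at ht
      have ht' : t ∈ Icc a b := ⟨ht.1.le, ht.2⟩
      exact ((hmass t ht').add (hhlim t ht')).congr fun n => (hF n t ht').symm
  have hfin := tendsto_nhds_unique (((hleft b hmb).sub (hleft a hma)).congr fun n => (key n).2) hout
  have hcc : ContinuousOn (fun t => φx t (y t) * p t (y t)) (uIcc a b) := by
    rw [uIcc_of_le hab]
    have : Continuous (fun t => φx t (Y t) * q t (Y t)) :=
      (cφx.comp (continuous_id.prodMk cY)).mul (cq.comp (continuous_id.prodMk cY))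
    refine this.continuousOn.congr fun t ht => ?_
    simp only; rw [hY t ht, hq t ht _ le_rfl]
  have hneg : IntervalIntegrable (fun t => - m' t) volume a b := cm'.neg.intervalIntegrable _ _
  rw [intervalIntegral.integral_add hneg (hcc.intervalIntegrable.const_mul _),
    intervalIntegral.integral_neg, intervalIntegral.integral_const_mul,
    intervalIntegral.integral_eq_sub_of_hasDerivAt_of_le (f := m) hab cφY.continuousOn
      (fun t ht => (dm t ⟨ht.1.le, ht.2.le⟩).hasDerivAt (Icc_mem_nhds ht.1 ht.2)) (cm'.intervalIntegrable _ _)] at hfin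
  linarith

end IsFBPSol

/-- The heat kernel and its space derivatives. -/
noncomputable def hk (τ x : ℝ) : ℝ := (√(2 * Real.pi * τ))⁻¹ * Real.exp (-(x ^ 2) / (2 * τ))
noncomputable def hkx (τ x : ℝ) : ℝ := -(x / τ) * hk τ x
noncomputable def hkxx (τ x : ℝ) : ℝ := (x ^ 2 / τ ^ 2 - 1 / τ) * hk τ x

lemma hk_pos {τ : ℝ} (h : 0 < τ) (x : ℝ) : 0 < hk τ x := by unfold hk; positivity

lemma hk_comp {A X : ℝ → ℝ} {A' X' t : ℝ} {s : Set ℝ} (hA : HasDerivWithinAt A A' s t)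
    (hX : HasDerivWithinAt X X' s t) (h : 0 < A t) :
    HasDerivWithinAt (fun r => hk (A r) (X r)) (1 / 2 * hkxx (A t) (X t) * A' + hkx (A t) (X t) * X') s t := by
  have h1 : HasDerivWithinAt (fun r => (√(2 * Real.pi * A r))⁻¹)
      (-(2 * Real.pi * A' / (2 * √(2 * Real.pi * A t))) / √(2 * Real.pi * A t) ^ 2) s t :=
    ((hA.const_mul (2 * Real.pi)).sqrt (by positivity)).inv (by positivity)
  have h2 : HasDerivWithinAt (fun r => Real.exp (-(X r ^ 2) / (2 * A r)))
      (Real.exp (-(X t ^ 2) / (2 * A t)) *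
        ((-(2 * X t * X') * (2 * A t) - -(X t ^ 2) * (2 * A')) / (2 * A t) ^ 2)) s t := by
    have := ((hX.pow 2).neg.div (hA.const_mul 2) (by positivity)).exp
    simpa using this
  refine (h1.mul h2).congr_deriv ?_
  unfold hkxx hkx hk
  rw [Real.sq_sqrt (by positivity)]
  have hs : 0 < √(2 * Real.pi * A t) := by positivity
  have hp := Real.pi_pos
  field_simp
  ring

lemma hk_dx {τ : ℝ} (h : 0 < τ) (x : ℝ) : HasDerivAt (hk τ) (hkx τ x) x := by
  have := hk_comp (A := fun _ => τ) (X := fun r => r) (s := univ) (t := x)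
    (hasDerivWithinAt_const _ _ _) (hasDerivWithinAt_id _ _) h
  rw [hasDerivWithinAt_univ] at this
  exact this.congr_deriv (by ring)

lemma hkx_dx {τ : ℝ} (h : 0 < τ) (x : ℝ) : HasDerivAt (hkx τ) (hkxx τ x) x := by
  have := (((hasDerivAt_id x).div_const τ).neg).mul (hk_dx h x)
  refine this.congr_deriv ?_
  unfold hkxx hkx; simp; field_simp; ring

lemma hk_cont {Z : Type*} [TopologicalSpace Z] {A X : Z → ℝ} (hA : Continuous A) (hX : Continuous X)
    (h : ∀ z, 0 < A z) : Continuous (fun z => hk (A z) (X z)) := by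
  unfold hk
  refine Continuous.mul (Continuous.inv₀ (by fun_prop) fun z => ?_) (Real.continuous_exp.comp
    (Continuous.div (by fun_prop) (by fun_prop) fun z => ?_))
  · have := h z; positivity
  · have := h z; positivity

lemma hkx_cont {Z : Type*} [TopologicalSpace Z] {A X : Z → ℝ} (hA : Continuous A) (hX : Continuous X)
    (h : ∀ z, 0 < A z) : Continuous (fun z => hkx (A z) (X z)) := by
  unfold hkx
  exact (hX.div hA fun z => (h z).ne').neg.mul (hk_cont hA hX h)

lemma hkxx_cont {Z : Type*} [TopologicalSpace Z] {A X : Z → ℝ} (hA : Continuous A) (hX : Continuous X)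
    (h : ∀ z, 0 < A z) : Continuous (fun z => hkxx (A z) (X z)) := by
  unfold hkxx
  exact (((hX.pow 2).div (hA.pow 2) fun z => pow_ne_zero 2 (h z).ne').sub
    (continuous_const.div hA fun z => (h z).ne')).mul (hk_cont hA hX h)

lemma hk_le {τ : ℝ} (h : 0 < τ) (x : ℝ) : hk τ x ≤ (√τ)⁻¹ := by
  unfold hk
  have h1 : (√(2 * Real.pi * τ))⁻¹ ≤ (√τ)⁻¹ := by
    apply inv_anti₀ (by positivity)
    apply Real.sqrt_le_sqrt
    nlinarith [Real.pi_gt_three]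
  have h2 : Real.exp (-(x ^ 2) / (2 * τ)) ≤ 1 := by
    rw [Real.exp_le_one_iff]
    apply div_nonpos_of_nonpos_of_nonneg
    · nlinarith [sq_nonneg x]
    · linarith
  calc _ ≤ (√τ)⁻¹ * 1 := mul_le_mul h1 h2 (Real.exp_pos _).le (by positivity)
    _ = _ := mul_one _

lemma hkx_le {τ : ℝ} (h : 0 < τ) (x : ℝ) : |hkx τ x| ≤ |x| / (τ * √τ) := by
  unfold hkx
  rw [abs_mul, abs_neg, abs_div, abs_of_pos h, abs_of_pos (hk_pos h x)]
  calc |x| / τ * hk τ x ≤ |x| / τ * (√τ)⁻¹ := mul_le_mul_of_nonneg_left (hk_le h x) (by positivity)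
    _ = _ := by field_simp

lemma hkxx_le {τ : ℝ} (h : 0 < τ) (x : ℝ) : |hkxx τ x| ≤ 3 / (τ * √τ) := by
  have hu : ∀ u : ℝ, 0 ≤ u → (2 * u + 1) * Real.exp (-u) ≤ 3 := by
    intro u hu
    have h1 : u + 1 ≤ Real.exp u := Real.add_one_le_exp u
    rw [Real.exp_neg, ← div_eq_mul_inv, div_le_iff₀ (Real.exp_pos u)]
    nlinarith
  have h1 : (√(2 * Real.pi * τ))⁻¹ ≤ (√τ)⁻¹ := by
    apply inv_anti₀ (by positivity)
    apply Real.sqrt_le_sqrt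
    nlinarith [Real.pi_gt_three]
  unfold hkxx
  rw [abs_mul, abs_of_pos (hk_pos h x)]
  have h2 : |x ^ 2 / τ ^ 2 - 1 / τ| ≤ (2 * (x ^ 2 / (2 * τ)) + 1) / τ := by
    have e : (2 * (x ^ 2 / (2 * τ)) + 1) / τ = x ^ 2 / τ ^ 2 + 1 / τ := by field_simp
    rw [e, abs_le]
    have : 0 ≤ x ^ 2 / τ ^ 2 := by positivity
    have : 0 ≤ 1 / τ := by positivity
    constructor <;> linarith
  have h3 := hu (x ^ 2 / (2 * τ)) (by positivity)
  have h4 : hk τ x = (√(2 * Real.pi * τ))⁻¹ * Real.exp (-(x ^ 2 / (2 * τ))) := by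
    unfold hk; rw [neg_div]
  calc |x ^ 2 / τ ^ 2 - 1 / τ| * hk τ x ≤ (2 * (x ^ 2 / (2 * τ)) + 1) / τ * hk τ x :=
        mul_le_mul_of_nonneg_right h2 (hk_pos h x).le
    _ = ((2 * (x ^ 2 / (2 * τ)) + 1) * Real.exp (-(x ^ 2 / (2 * τ)))) * ((√(2 * Real.pi * τ))⁻¹ / τ) := by
        rw [h4]; ring
    _ ≤ 3 * ((√τ)⁻¹ / τ) := by
        apply mul_le_mul h3 _ (by positivity) (by norm_num)
        gcongr
    _ = 3 / (τ * √τ) := by field_simp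

lemma hkx_le' {τ : ℝ} (h : 0 < τ) (x : ℝ) : |hkx τ x| ≤ 1 / τ := by
  unfold hkx
  rw [abs_mul, abs_neg, abs_div, abs_of_pos h, abs_of_pos (hk_pos h x)]
  suffices |x| * hk τ x ≤ 1 by
    calc |x| / τ * hk τ x = (|x| * hk τ x) / τ := by ring
      _ ≤ 1 / τ := by gcongr
  have hp : 0 < √(2 * Real.pi * τ) := by positivity
  have h4 : hk τ x = Real.exp (-(x ^ 2 / (2 * τ))) / √(2 * Real.pi * τ) := by
    unfold hk; rw [neg_div]; field_simp
  have hE := Real.exp_pos (x ^ 2 / (2 * τ))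
  rw [h4, Real.exp_neg, ← mul_div_assoc, ← div_eq_mul_inv, div_div, div_le_one (by positivity)]
  have h1 : x ^ 2 / (2 * τ) + 1 ≤ Real.exp (x ^ 2 / (2 * τ)) := Real.add_one_le_exp _
  have hs : √τ ≤ √(2 * Real.pi * τ) := Real.sqrt_le_sqrt (by nlinarith [Real.pi_gt_three])
  have hs' : √τ * 2 ≤ √(2 * Real.pi * τ) := by
    rw [show (2:ℝ) = √4 by rw [show (4:ℝ) = 2 ^ 2 by norm_num]; simp, ← Real.sqrt_mul h.le]
    apply Real.sqrt_le_sqrt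
    rw [show √(4:ℝ) = 2 by rw [show (4:ℝ) = 2 ^ 2 by norm_num]; simp]
    nlinarith [Real.pi_gt_three]
  have hτ : 0 < √τ := by positivity
  calc |x| ≤ (x ^ 2 / (2 * τ) + 1) * (√τ * 2) := by
        have e : (x ^ 2 / (2 * τ) + 1) * (√τ * 2) = ((|x|) ^ 2 + 2 * (√τ) ^ 2) / √τ := by
          rw [sq_abs]
          nth_rewrite 1 [← Real.sq_sqrt h.le]
          field_simp
        rw [e, le_div_iff₀ hτ]
        nlinarith [sq_nonneg (|x| - √τ), abs_nonneg x]
    _ ≤ Real.exp (x ^ 2 / (2 * τ)) * √(2 * Real.pi * τ) := by gcongr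

lemma hk_lip {τ : ℝ} (h : 0 < τ) (x x' : ℝ) : |hk τ x - hk τ x'| ≤ 1 / τ * |x - x'| := by
  exact Convex.norm_image_sub_le_of_norm_hasDerivWithin_le (f := hk τ) (f' := hkx τ) (s := univ) (C := 1 / τ)
      (x := x') (y := x) (fun x _ => (hk_dx h x).hasDerivWithinAt) (fun x _ => hkx_le' h x)
      convex_univ (mem_univ _) (mem_univ _)

lemma hkx_lip {τ : ℝ} (h : 0 < τ) (x x' : ℝ) : |hkx τ x - hkx τ x'| ≤ 3 / (τ * √τ) * |x - x'| := by
  exact Convex.norm_image_sub_le_of_norm_hasDerivWithin_le (f := hkx τ) (f' := hkxx τ) (s := univ) (C := 3 / (τ * √τ))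
      (x := x') (y := x) (fun x _ => (hkx_dx h x).hasDerivWithinAt) (fun x _ => hkxx_le h x)
      convex_univ (mem_univ _) (mem_univ _)

/-- Lipschitz in time. -/
lemma hk_lip_t {c τ τ' : ℝ} (hc : 0 < c) (h : c ≤ τ) (h' : c ≤ τ') (x : ℝ) :
    |hk τ x - hk τ' x| ≤ 3 / (c * √c) * |τ - τ'| := by
  refine Convex.norm_image_sub_le_of_norm_hasDerivWithin_le (f := fun τ => hk τ x) (f' := fun τ => 1 / 2 * hkxx τ x)
    (s := Ici c) (C := 3 / (c * √c)) (x := τ') (y := τ) (fun r hr => ?_) (fun r hr => ?_)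
      (convex_Ici c) h' h
  · have := hk_comp (A := fun r => r) (X := fun _ => x) (s := Ici c) (t := r)
      (hasDerivWithinAt_id _ _) (hasDerivWithinAt_const _ _ _) (hc.trans_le hr)
    exact this.congr_deriv (by ring)
  · have hr' : c ≤ r := hr
    have := hkxx_le (hc.trans_le hr') x
    rw [Real.norm_eq_abs, abs_mul, abs_of_pos (by norm_num : (0:ℝ) < 1 / 2)]
    have h3 : 3 / (r * √r) ≤ 3 / (c * √c) := by
      have := hc.trans_le hr'
      gcongr
    have := abs_nonneg (hkxx r x)
    linarith

namespace IsFBPSol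
variable {K v T : ℝ} {π₀ : Measure ℝ} {p pt px pxx : ℝ → ℝ → ℝ} {y y' y'' : ℝ → ℝ}

lemma hk_id (H : IsFBPSol K v T π₀ p pt px pxx y y' y'') {a b τ : ℝ} (ha : 0 < a) (hab : a ≤ b)
    (hb : b ≤ T) (hτ : b < τ) (z : ℝ) :
    (∫ x, p b x * hk (τ - b) (x - z)) - (∫ x, p a x * hk (τ - a) (x - z)) =
      1 / 2 * ∫ t in a..b, hkx (τ - t) (y t - z) * p t (y t) := by
  have hpos : ∀ t, 0 < τ - cl a b t := fun t => by linarith [(cl_mem hab t).2]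
  have hyc : ContinuousOn y (Icc a b) := H.y_cont.mono (Icc_subset_Icc ha.le hb)
  have hyc' : ContinuousOn y' (Icc a b) := H.y'_cont.mono (Icc_subset_Icc ha.le hb)
  have cY := comp_cl hab hyc
  have cY' := comp_cl hab hyc'
  have ccl := cl_cont a b
  have cA : Continuous (fun q : ℝ × ℝ => τ - cl a b q.1) := by fun_prop
  have cX : Continuous (fun q : ℝ × ℝ => q.2 - z) := by fun_prop
  have cA1 : Continuous (fun t : ℝ => τ - cl a b t) := by fun_prop
  have dcl : ∀ t ∈ Icc a b, HasDerivWithinAt (fun t => τ - cl a b t) (-1) (Icc a b) t := by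
    intro t ht
    have h1 : HasDerivWithinAt (fun t => τ - t) (-1) (Icc a b) t := by
      simpa using (hasDerivWithinAt_id t (Icc a b)).const_sub τ
    exact h1.congr_of_mem (fun s hs => by simp only [cl_eq hs]) ht
  have dY : ∀ t ∈ Icc a b, HasDerivWithinAt (fun t => y (cl a b t)) (y' (cl a b t)) (Icc a b) t := by
    intro t ht
    have h1 := (H.y_deriv t ⟨ha.le.trans ht.1, ht.2.trans hb⟩).mono (Icc_subset_Icc ha.le hb)
    rw [cl_eq ht]
    exact h1.congr_of_mem (fun s hs => by simp only [cl_eq hs]) ht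
  set M := (√(τ - b))⁻¹ + (τ - b)⁻¹ with hM
  have hτb : 0 < τ - b := by linarith
  have := H.weak_bdry (M := M) (φ := fun t x => hk (τ - cl a b t) (x - z))
    (φx := fun t x => hkx (τ - cl a b t) (x - z)) (φxx := fun t x => hkxx (τ - cl a b t) (x - z))
    (φt := fun t x => - (1 / 2 * hkxx (τ - cl a b t) (x - z)))
    (m' := fun t => 1 / 2 * hkxx (τ - cl a b t) (y (cl a b t) - z) * (-1) +
      hkx (τ - cl a b t) (y (cl a b t) - z) * y' (cl a b t))
    ha hab hb ⟨fun t ht x => ?_, fun t ht x => ?_, fun t ht x => ?_, hk_cont cA cX fun q => hpos _,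
      ((hkxx_cont cA cX fun q => hpos _).const_mul _).neg, hkxx_cont cA cX fun q => hpos _⟩
    (hkx_cont cA cX fun q => hpos _) (fun t ht x => ?_) (fun t ht x => rfl)
    cY cY' ?_ dY (fun t ht => ?_) (fun t ht => by simp only [cl_eq ht])
  · simp only [cl_eq (show a ∈ Icc a b from ⟨le_rfl, hab⟩), cl_eq (show b ∈ Icc a b from ⟨hab, le_rfl⟩)] at this
    rw [this]
    congr 1
    apply intervalIntegral.integral_congr
    intro t ht
    rw [uIcc_of_le hab] at ht
    simp only [cl_eq ht]
  · exact (hk_comp (dcl t ht) (hasDerivWithinAt_const _ _ (x - z)) (hpos t)).congr_deriv (by ring)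
  · exact (hk_dx (hpos t) (x - z)).comp_sub_const x z
  · exact (hkx_dx (hpos t) (x - z)).comp_sub_const x z
  · have h1 : τ - b ≤ τ - cl a b t := by linarith [(cl_mem hab t).2]
    have h2 := hpos t
    constructor
    · rw [abs_of_pos (hk_pos h2 _)]
      refine (hk_le h2 _).trans ?_
      have : (√(τ - cl a b t))⁻¹ ≤ (√(τ - b))⁻¹ := by gcongr
      have : 0 < (τ - b)⁻¹ := by positivity
      linarith
    · refine (hkx_le' h2 _).trans ?_
      have : 1 / (τ - cl a b t) ≤ (τ - b)⁻¹ := by rw [one_div]; gcongr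
      have : 0 < (√(τ - b))⁻¹ := by positivity
      linarith
  · have cYz : Continuous (fun t => y (cl a b t) - z) := cY.sub continuous_const
    exact (((hkxx_cont cA1 cYz hpos).const_mul _).mul_const _).add ((hkx_cont cA1 cYz hpos).mul cY')
  · exact hk_comp (dcl t ht) ((dY t ht).sub_const z) (hpos t)

end IsFBPSol

lemma hk_mass : ∫ x, hk 1 x = 1 := by
  have h := integral_gaussian (1 / 2)
  have e : ∀ x, hk 1 x = (√(2 * Real.pi))⁻¹ * Real.exp (-(1 / 2) * x ^ 2) := by
    intro x; unfold hk; congr 2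
    · rw [mul_one]
    · ring
  simp_rw [e]
  rw [integral_const_mul, h, show Real.pi / (1 / 2) = 2 * Real.pi by ring]
  exact inv_mul_cancel₀ (by positivity)

lemma hk_decay : Tendsto (fun x : ℝ => ‖x‖ ^ Module.finrank ℝ ℝ * hk 1 x) (Bornology.cobounded ℝ) (𝓝 0) := by
  have h := (tendsto_rpow_abs_mul_exp_neg_mul_sq_cocompact (a := 1 / 2) (by norm_num) 1).const_mul (√(2 * Real.pi))⁻¹
  rw [mul_zero, ← Metric.cobounded_eq_cocompact] at h
  refine h.congr fun x => ?_
  unfold hk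
  rw [Module.finrank_self, pow_one, Real.rpow_one, mul_one, Real.norm_eq_abs,
    show -(1 / 2) * x ^ 2 = -(x ^ 2) / (2 * 1) by ring]
  ring

lemma hk_scale {c : ℝ} (hc : 0 < c) (u : ℝ) : hk (c ^ 2)⁻¹ u = c * hk 1 (c * u) := by
  unfold hk
  have e1 : √(2 * Real.pi * (c ^ 2)⁻¹) = √(2 * Real.pi * 1) * c⁻¹ := by
    rw [mul_one, Real.sqrt_mul (by positivity), ← inv_pow, Real.sqrt_sq (by positivity)]
  rw [e1, mul_inv, inv_inv, show -(u ^ 2) / (2 * (c ^ 2)⁻¹) = -((c * u) ^ 2) / (2 * 1) by field_simp]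
  ring

lemma hk_even (τ u : ℝ) : hk τ |u| = hk τ u := by unfold hk; rw [sq_abs]
lemma hk_neg (τ u : ℝ) : hk τ (-u) = hk τ u := by unfold hk; rw [neg_sq]

/-- The sequence of times used for approximate identities. -/
noncomputable def et (n : ℕ) : ℝ := (((n : ℝ) + 1) ^ 2)⁻¹
lemma et_pos (n : ℕ) : 0 < et n := by unfold et; positivity
lemma et_tendsto : Tendsto et atTop (𝓝 0) := by
  have h := (tendsto_one_div_add_atTop_nhds_zero_nat (𝕜 := ℝ)).pow 2
  rw [zero_pow (by norm_num)] at h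
  refine h.congr fun n => ?_
  unfold et; rw [div_pow, one_pow, one_div]

lemma hk_peak {g : ℝ → ℝ} {z : ℝ} (hg : Integrable g) (hc : ContinuousAt g z) :
    Tendsto (fun n => ∫ x, g x * hk (et n) (x - z)) atTop (𝓝 (g z)) := by
  have h := tendsto_integral_comp_smul_smul_of_integrable' (μ := volume) (φ := hk 1)
    (fun x => (hk_pos one_pos x).le) hk_mass hk_decay hg hc
  have h2 : Tendsto (fun n : ℕ => (n : ℝ) + 1) atTop atTop :=
    tendsto_atTop_add_const_right _ _ tendsto_natCast_atTop_atTop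
  refine (h.comp h2).congr fun n => ?_
  simp only [Function.comp]
  apply integral_congr_ae
  refine Eventually.of_forall fun x => ?_
  simp only [Module.finrank_self, pow_one, smul_eq_mul]
  have hn : (0 : ℝ) < (n : ℝ) + 1 := by positivity
  rw [et, hk_scale hn, ← hk_neg 1 (_ * (x - z))]
  rw [show -(((n : ℝ) + 1) * (x - z)) = ((n : ℝ) + 1) * (z - x) by ring]
  ring

namespace IsFBPSol
variable {K v T : ℝ} {π₀ : Measure ℝ} {p pt px pxx : ℝ → ℝ → ℝ} {y y' y'' : ℝ → ℝ}

lemma y_bdd (H : IsFBPSol K v T π₀ p pt px pxx y y' y'') :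
    ∃ L : ℝ, 0 ≤ L ∧ (∀ t ∈ Icc 0 T, |y t| ≤ L) ∧ ∀ s ∈ Icc 0 T, ∀ t ∈ Icc 0 T, |y s - y t| ≤ L * |s - t| := by
  obtain ⟨L1, h1⟩ := isCompact_Icc.exists_bound_of_continuousOn H.y_cont
  obtain ⟨L2, h2⟩ := isCompact_Icc.exists_bound_of_continuousOn H.y'_cont
  refine ⟨max 0 (max L1 L2), le_max_left _ _, fun t ht => (h1 t ht).trans ((le_max_left _ _).trans (le_max_right _ _)),
    fun s hs t ht => ?_⟩
  exact Convex.norm_image_sub_le_of_norm_hasDerivWithin_le (f := y) (f' := y') (s := Icc 0 T)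
    (x := t) (y := s) (fun x hx => H.y_deriv x hx)
    (fun x hx => (h2 x hx).trans ((le_max_right _ _).trans (le_max_right _ _))) (convex_Icc _ _) ht hs

lemma f_cont (H : IsFBPSol K v T π₀ p pt px pxx y y' y'') : ContinuousOn (fun t => p t (y t)) (Ioc 0 T) := by
  have h : ContinuousOn (fun t => ((t, y t) : ℝ × ℝ)) (Ioc 0 T) :=
    continuousOn_id.prodMk (H.y_cont.mono Ioc_subset_Icc_self)
  exact H.p_cont.comp h fun t ht => ⟨ht, le_rfl⟩

lemma f_nonneg (H : IsFBPSol K v T π₀ p pt px pxx y y' y'') {t : ℝ} (ht : t ∈ Ioc 0 T) : 0 ≤ p t (y t) :=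
  H.p_nonneg t ht _

lemma f_int (H : IsFBPSol K v T π₀ p pt px pxx y y' y'') (hT : 0 < T) :
    IntegrableOn (fun t => p t (y t)) (Ioc 0 T) := by
  obtain ⟨L, hL0, hL, -⟩ := H.y_bdd
  -- positive lower bound of the kernel
  set g : ℝ → ℝ := fun t => hkx (T + 1 - t) (y t - (L + 1)) with hg
  have hgc : ContinuousOn g (Icc 0 T) := by
    have h0 := comp_cl hT.le H.y_cont
    have h1 := cl_cont 0 T
    have h2 : Continuous (fun t => hkx (T + 1 - cl 0 T t) (y (cl 0 T t) - (L + 1))) :=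
      hkx_cont (by fun_prop) (h0.sub continuous_const) fun t => by linarith [(cl_mem hT.le t).2]
    exact h2.continuousOn.congr fun t ht => by simp only [hg, cl_eq ht]
  have hgpos : ∀ t ∈ Icc 0 T, 0 < g t := by
    intro t ht
    have h1 : 0 < T + 1 - t := by linarith [ht.2]
    have h2 := (abs_le.1 (hL t ht)).2
    have h3 := hk_pos h1 (y t - (L + 1))
    have h4 : 0 < -((y t - (L + 1)) / (T + 1 - t)) := by
      rw [← neg_div]; apply div_pos _ h1; linarith
    simp only [hg, hkx]; positivity
  obtain ⟨t0, ht0, hmin⟩ := isCompact_Icc.exists_isMinOn ⟨0, ⟨le_rfl, hT.le⟩⟩ hgc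
  set c := g t0 with hc
  have hcpos : 0 < c := hgpos t0 ht0
  have hcle : ∀ t ∈ Icc 0 T, c ≤ g t := fun t ht => hmin ht
  have hfa : ∀ a, 0 < a → ContinuousOn (fun t => p t (y t)) (Icc a T) := fun a ha =>
    H.f_cont.mono fun t ht => ⟨ha.trans_le ht.1, ht.2⟩
  have hr : ∀ n : ℕ, 0 < T / ((n : ℝ) + 1) ∧ T / ((n : ℝ) + 1) ≤ T := by
    intro n
    have : (0:ℝ) ≤ n := Nat.cast_nonneg n
    refine ⟨by positivity, div_le_self hT.le (by linarith)⟩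
  refine integrableOn_Ioc_of_intervalIntegral_norm_bounded_left (l := atTop) (a := fun n : ℕ => T / ((n : ℝ) + 1))
    (I := 4 / c) (fun n => ?_) ?_ (Eventually.of_forall fun n => ?_)
  · exact ((hfa _ (hr n).1).integrableOn_Icc).mono_set Ioc_subset_Icc_self
  · have := (tendsto_one_div_add_atTop_nhds_zero_nat (𝕜 := ℝ)).const_mul T
    rw [mul_zero] at this
    exact this.congr fun n => by ring
  · obtain ⟨ha, haT⟩ := hr n
    set a := T / ((n : ℝ) + 1)
    have hid := H.hk_id ha haT le_rfl (τ := T + 1) (by linarith) (L + 1)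
    have hk1 : ∀ t ∈ Icc a T, |∫ x, p t x * hk (T + 1 - t) (x - (L + 1))| ≤ 1 := by
      intro t ht
      refine H.pg_bound ⟨ha.trans_le ht.1, ht.2⟩ fun x => ?_
      have h1 : 1 ≤ T + 1 - t := by linarith [ht.2]
      rw [abs_of_pos (hk_pos (by linarith) _)]
      refine (hk_le (by linarith) _).trans (inv_le_one_of_one_le₀ ?_)
      rw [Real.one_le_sqrt]; exact h1
    have b1 := abs_le.1 (hk1 T ⟨haT, le_rfl⟩)
    have b2 := abs_le.1 (hk1 a ⟨le_rfl, haT⟩)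
    have hI : IntervalIntegrable (fun t => p t (y t)) volume a T := by
      apply ContinuousOn.intervalIntegrable; rw [uIcc_of_le haT]; exact hfa a ha
    have hmono : ∫ t in a..T, c * p t (y t) ≤ ∫ t in a..T, g t * p t (y t) := by
      refine intervalIntegral.integral_mono_on haT (hI.const_mul c) ?_ fun t ht => ?_
      · apply ContinuousOn.intervalIntegrable; rw [uIcc_of_le haT]
        exact (hgc.mono (Icc_subset_Icc ha.le le_rfl)).mul (hfa a ha)
      · exact mul_le_mul_of_nonneg_right (hcle t ⟨ha.le.trans ht.1, ht.2⟩) (H.f_nonneg ⟨ha.trans_le ht.1, ht.2⟩)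
    rw [intervalIntegral.integral_const_mul] at hmono
    have e : ∫ t in Ioc a T, ‖p t (y t)‖ = ∫ t in a..T, p t (y t) := by
      rw [intervalIntegral.integral_of_le haT]
      refine setIntegral_congr_fun measurableSet_Ioc fun t ht => ?_
      simp only [Real.norm_eq_abs]
      exact abs_of_nonneg (H.f_nonneg ⟨ha.trans ht.1, ht.2⟩)
    rw [e, le_div_iff₀ hcpos]
    linarith

lemma init_hk (H : IsFBPSol K v T π₀ p pt px pxx y y' y'') (hT : 0 < T) {τ : ℝ} (hτ : 0 < τ) (z : ℝ) :
    Tendsto (fun a => ∫ x, p a x * hk (τ - a) (x - z)) (𝓝[>] 0) (𝓝 (∫ x, hk τ (x - z) ∂π₀)) := by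
  have hcont : Continuous (fun x => hk τ (x - z)) := hk_cont (by fun_prop) (by fun_prop) fun _ => hτ
  have hbd : ∀ x, |hk τ (x - z)| ≤ (√τ)⁻¹ := fun x => by
    rw [abs_of_pos (hk_pos hτ _)]; exact hk_le hτ _
  have h1 := H.init (BoundedContinuousFunction.ofNormedAddCommGroup (fun x => hk τ (x - z)) hcont (√τ)⁻¹ hbd)
  simp only [BoundedContinuousFunction.coe_ofNormedAddCommGroup] at h1
  have h2 : Tendsto (fun a => (∫ x, p a x * hk (τ - a) (x - z)) - ∫ x, hk τ (x - z) * p a x) (𝓝[>] 0) (𝓝 0) := by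
    set C := 3 / (τ / 2 * √(τ / 2)) with hC
    have h3 : Tendsto (fun a : ℝ => C * a) (𝓝[>] 0) (𝓝 0) := by
      have : Tendsto (fun a : ℝ => C * a) (𝓝 0) (𝓝 (C * 0)) := (continuous_const.mul continuous_id).tendsto 0
      rw [mul_zero] at this
      exact this.mono_left nhdsWithin_le_nhds
    refine squeeze_zero_norm' ?_ h3
    filter_upwards [Ioo_mem_nhdsGT (lt_min hT (half_pos hτ))] with a ha
    have haT : a ∈ Ioc 0 T := ⟨ha.1, (ha.2.trans_le (min_le_left _ _)).le⟩
    have haτ : a < τ / 2 := ha.2.trans_le (min_le_right _ _)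
    have hp : 0 < τ - a := by linarith
    simp only [mul_comm (hk τ _)]
    rw [← integral_sub (H.pg_int haT (hk_cont (by fun_prop) (by fun_prop) fun _ => hp) (C := (√(τ - a))⁻¹)
      fun x => by rw [abs_of_pos (hk_pos hp _)]; exact hk_le hp _) (H.pg_int haT hcont hbd)]
    simp only [← mul_sub]
    refine H.pg_bound haT fun x => ?_
    have := hk_lip_t (c := τ / 2) (half_pos hτ) (show τ / 2 ≤ τ - a by linarith) (show τ / 2 ≤ τ by linarith) (x - z)
    refine this.trans (le_of_eq ?_)
    rw [show τ - a - τ = -a by ring, abs_neg, abs_of_pos ha.1]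
  have := h2.add h1
  simpa using this

/-- Representation with positive regularisation. -/
lemma repr_eta (H : IsFBPSol K v T π₀ p pt px pxx y y' y'') (hT : 0 < T) {t η : ℝ} (ht : t ∈ Ioc 0 T)
    (hη : 0 < η) (z : ℝ) :
    (∫ x, p t x * hk η (x - z)) = (∫ x, hk (t + η) (x - z) ∂π₀) +
      1 / 2 * ∫ s in (0:ℝ)..t, hkx (t + η - s) (y s - z) * p s (y s) := by
  have hint : IntegrableOn (fun s => hkx (t + η - s) (y s - z) * p s (y s)) (uIcc 0 t) := by
    rw [uIcc_of_le ht.1.le, integrableOn_Icc_iff_integrableOn_Ioc]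
    refine Integrable.bdd_mul (c := 1 / η) ((H.f_int hT).mono_set (Ioc_subset_Ioc le_rfl ht.2)) ?_ ?_
    · have h0 := comp_cl ht.1.le (H.y_cont.mono (Icc_subset_Icc le_rfl ht.2))
      have h1 := cl_cont 0 t
      have h2 : Continuous (fun s => hkx (t + η - cl 0 t s) (y (cl 0 t s) - z)) :=
        hkx_cont (by fun_prop) (h0.sub continuous_const) fun s => by linarith [(cl_mem ht.1.le s).2]
      refine (h2.continuousOn.congr fun s hs => ?_).aestronglyMeasurable measurableSet_Ioc
      simp only [cl_eq (Ioc_subset_Icc_self hs)]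
    · refine (ae_restrict_iff' measurableSet_Ioc).2 (Eventually.of_forall fun s hs => ?_)
      have : η ≤ t + η - s := by linarith [hs.2]
      refine (hkx_le' (hη.trans_le this) _).trans ?_
      gcongr
  have hcw : Tendsto (fun a => ∫ s in (0:ℝ)..a, hkx (t + η - s) (y s - z) * p s (y s)) (𝓝[>] 0) (𝓝 0) := by
    have := intervalIntegral.continuousOn_primitive_interval hint 0 (by simp)
    rw [ContinuousWithinAt, intervalIntegral.integral_same, uIcc_of_le ht.1.le] at this
    exact this.mono_left (nhdsWithin_le_of_mem (mem_of_superset (Ioc_mem_nhdsGT ht.1) Ioc_subset_Icc_self))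
  have hL := H.init_hk hT (τ := t + η) (by linarith [ht.1]) z
  have hR : Tendsto (fun a => 1 / 2 * ((∫ s in (0:ℝ)..t, hkx (t + η - s) (y s - z) * p s (y s)) -
      ∫ s in (0:ℝ)..a, hkx (t + η - s) (y s - z) * p s (y s))) (𝓝[>] 0)
      (𝓝 (1 / 2 * ((∫ s in (0:ℝ)..t, hkx (t + η - s) (y s - z) * p s (y s)) - 0))) :=
    (hcw.const_sub _).const_mul _
  have hE : Tendsto (fun _ : ℝ => ∫ x, p t x * hk η (x - z)) (𝓝[>] 0) (𝓝 (∫ x, p t x * hk η (x - z))) :=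
    tendsto_const_nhds
  have := tendsto_nhds_unique (hE.congr' ?_) (hL.add hR)
  · rw [this]; ring
  · filter_upwards [Ioc_mem_nhdsGT ht.1] with a ha
    have hid := H.hk_id ha.1 ha.2 ht.2 (τ := t + η) (by linarith) z
    have hii : ∀ r ∈ Icc 0 t, IntervalIntegrable (fun s => hkx (t + η - s) (y s - z) * p s (y s)) volume 0 r := by
      intro r hr
      refine (hint.mono_set ?_).intervalIntegrable
      exact uIcc_subset_uIcc left_mem_uIcc (by rw [uIcc_of_le ht.1.le]; exact hr)
    have hsub := intervalIntegral.integral_interval_sub_left (hii t ⟨ht.1.le, le_rfl⟩) (hii a ⟨ha.1.le, ha.2⟩)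
    rw [hsub]
    rw [show t + η - t = η by ring] at hid
    linarith

/-- `s ↦ (t-s)^{-1/2} f(s)` is integrable. -/
lemma sing_int (H : IsFBPSol K v T π₀ p pt px pxx y y' y'') (hT : 0 < T) {t : ℝ} (ht : t ∈ Ioc 0 T) :
    IntegrableOn (fun s => (√(t - s))⁻¹ * p s (y s)) (Ioc 0 t) := by
  have ht2 : 0 < t / 2 := half_pos ht.1
  rw [← Ioc_union_Ioc_eq_Ioc ht2.le (half_le_self ht.1.le)]
  refine IntegrableOn.union ?_ ?_
  · refine Integrable.bdd_mul (c := (√(t / 2))⁻¹)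
      ((H.f_int hT).mono_set (Ioc_subset_Ioc le_rfl (by linarith [ht.2]))) ?_ ?_
    · exact (by fun_prop : Measurable fun s : ℝ => (√(t - s))⁻¹).aestronglyMeasurable
    · refine (ae_restrict_iff' measurableSet_Ioc).2 (Eventually.of_forall fun s hs => ?_)
      rw [Real.norm_eq_abs, abs_of_nonneg (by positivity)]
      apply inv_anti₀ (by positivity)
      apply Real.sqrt_le_sqrt; linarith [hs.2]
  · have hc : ContinuousOn (fun t => p t (y t)) (Icc (t / 2) t) :=
      H.f_cont.mono fun s hs => ⟨ht2.trans_le hs.1, hs.2.trans ht.2⟩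
    obtain ⟨B, hB⟩ := isCompact_Icc.exists_bound_of_continuousOn hc
    refine Integrable.mul_bdd (c := B) ?_ ((hc.mono Ioc_subset_Icc_self).aestronglyMeasurable measurableSet_Ioc) ?_
    · have h := intervalIntegral.intervalIntegrable_rpow' (a := 0) (b := t / 2) (r := -(1/2)) (by norm_num)
      have h2 := h.comp_sub_left t
      have h3 := h2.symm
      rw [intervalIntegrable_iff_integrableOn_Ioc_of_le (by linarith [ht.1])] at h3
      refine (h3.mono_set ?_).congr_fun (fun s hs => ?_) measurableSet_Ioc
      · apply Ioc_subset_Ioc <;> linarith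
      · simp only
        rw [Real.rpow_neg (by linarith [hs.2]), Real.sqrt_eq_rpow]
    · exact (ae_restrict_iff' measurableSet_Ioc).2 (Eventually.of_forall fun s hs => hB s (Ioc_subset_Icc_self hs))

lemma kern_bound {L s t d τ : ℝ} (hst : s < t) (hτ : t - s ≤ τ) (hd : |d| ≤ L * |s - t|) (hL : 0 ≤ L) :
    |hkx τ d| ≤ L * (√(t - s))⁻¹ := by
  have h0 : 0 < t - s := by linarith
  have hτ0 : 0 < τ := h0.trans_le hτ
  have hs : 0 < √(t - s) := by positivity
  rw [abs_sub_comm, abs_of_pos h0] at hd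
  refine (hkx_le hτ0 d).trans ?_
  calc |d| / (τ * √τ) ≤ (L * (t - s)) / ((t - s) * √(t - s)) := by gcongr
    _ = L * (√(t - s))⁻¹ := by field_simp

lemma f_limit (H : IsFBPSol K v T π₀ p pt px pxx y y' y'') {t : ℝ} (ht : t ∈ Ioc 0 T) :
    Tendsto (fun n => 2 * ∫ x, p t x * hk (et n) (x - y t)) atTop (𝓝 (p t (y t))) := by
  have hsh : Integrable (fun u => p t (y t + u)) := (H.p_int ht).comp_add_left (y t)
  have hab : Integrable (fun u => p t (y t + |u|)) := by
    have h1 : Integrable (fun u => p t (y t + u) + p t (y t + -u)) := hsh.add hsh.comp_neg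
    refine h1.congr ?_
    filter_upwards [compl_mem_ae_iff.2 (measure_singleton (μ := volume) (0:ℝ))] with u hu
    rcases lt_trichotomy u 0 with h | h | h
    · rw [abs_of_neg h, H.p_support t ht (y t + u) (by linarith), zero_add]
    · exact absurd h hu
    · rw [abs_of_pos h, H.p_support t ht (y t + -u) (by linarith), add_zero]
  have hc : ContinuousAt (fun u => p t (y t + |u|)) 0 := by
    have h : Continuous (fun u : ℝ => ((t, y t + |u|) : ℝ × ℝ)) := by fun_prop
    exact (H.p_cont.comp_continuous h fun u => ⟨ht, by simp⟩).continuousAt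
  have := hk_peak hab hc
  simp only [abs_zero, add_zero, sub_zero] at this
  refine this.congr fun n => ?_
  have e1 : ∫ u, p t (y t + |u|) * hk (et n) u = ∫ u, (fun r => p t (y t + r) * hk (et n) r) |u| := by
    simp only [hk_even]
  rw [e1, integral_comp_abs (f := fun r => p t (y t + r) * hk (et n) r)]
  congr 1
  rw [← integral_indicator measurableSet_Ioi, ← integral_add_left_eq_self (fun x => p t x * hk (et n) (x - y t)) (y t)]
  apply integral_congr_ae
  filter_upwards [compl_mem_ae_iff.2 (measure_singleton (μ := volume) (0:ℝ))] with u hu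
  rcases lt_trichotomy u 0 with h | h | h
  · rw [indicator_of_notMem (by simp [h.le]), H.p_support t ht (y t + u) (by linarith), zero_mul]
  · exact absurd h hu
  · rw [indicator_of_mem (show u ∈ Ioi (0:ℝ) from h)]
    simp

/-- The integral equation for the boundary trace. -/
lemma repr_f (H : IsFBPSol K v T π₀ p pt px pxx y y' y'') [IsProbabilityMeasure π₀] (hT : 0 < T) {t : ℝ}
    (ht : t ∈ Ioc 0 T) :
    p t (y t) = 2 * (∫ x, hk t (x - y t) ∂π₀) +
      ∫ s in (0:ℝ)..t, hkx (t - s) (y s - y t) * p s (y s) := by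
  obtain ⟨L, hL0, -, hL⟩ := H.y_bdd
  have hi : ∀ τ, 0 < τ → Integrable (fun x => hk τ (x - y t)) π₀ := by
    intro τ hτ
    refine Integrable.of_bound (C := (√τ)⁻¹) ?_ (Eventually.of_forall fun x => ?_)
    · exact (hk_cont (by fun_prop) (by fun_prop) fun _ => hτ).aestronglyMeasurable
    · rw [Real.norm_eq_abs, abs_of_pos (hk_pos hτ _)]; exact hk_le hτ _
  have l1 : Tendsto (fun n => ∫ x, hk (t + et n) (x - y t) ∂π₀) atTop (𝓝 (∫ x, hk t (x - y t) ∂π₀)) := by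
    refine tendsto_integral_of_dominated_convergence (fun _ => (√t)⁻¹) (fun n => ?_) (integrable_const _)
      (fun n => Eventually.of_forall fun x => ?_) (Eventually.of_forall fun x => ?_)
    · exact (hi _ (by linarith [ht.1, et_pos n])).aestronglyMeasurable
    · have h1 : 0 < t + et n := by linarith [ht.1, et_pos n]
      rw [Real.norm_eq_abs, abs_of_pos (hk_pos h1 _)]
      refine (hk_le h1 _).trans ?_
      have := ht.1
      apply inv_anti₀ (by positivity)
      apply Real.sqrt_le_sqrt; linarith [et_pos n]
    · rw [tendsto_iff_norm_sub_tendsto_zero]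
      have h2 := et_tendsto.const_mul (3 / (t * √t))
      rw [mul_zero] at h2
      refine squeeze_zero (fun _ => norm_nonneg _) (fun n => ?_) h2
      have := hk_lip_t ht.1 (show t ≤ t + et n by linarith [et_pos n]) le_rfl (x - y t)
      rwa [add_sub_cancel_left, abs_of_pos (et_pos n)] at this
  have l2 : Tendsto (fun n => ∫ s in (0:ℝ)..t, hkx (t + et n - s) (y s - y t) * p s (y s)) atTop
      (𝓝 (∫ s in (0:ℝ)..t, hkx (t - s) (y s - y t) * p s (y s))) := by
    refine intervalIntegral.tendsto_integral_filter_of_dominated_convergence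
      (fun s => L * ((√(t - s))⁻¹ * p s (y s))) (Eventually.of_forall fun n => ?_)
      (Eventually.of_forall fun n => ?_) ?_ ?_
    · rw [uIoc_of_le ht.1.le]
      have h0 := comp_cl ht.1.le (H.y_cont.mono (Icc_subset_Icc le_rfl ht.2))
      have h1 := cl_cont 0 t
      have h2 : Continuous (fun s => hkx (t + et n - cl 0 t s) (y (cl 0 t s) - y t)) :=
        hkx_cont (by fun_prop) (h0.sub continuous_const) fun s => by linarith [(cl_mem ht.1.le s).2, et_pos n]
      refine ((h2.continuousOn.congr fun s hs => ?_).mul (H.f_cont.mono (Ioc_subset_Ioc le_rfl ht.2))).aestronglyMeasurable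
        measurableSet_Ioc
      simp only [cl_eq (Ioc_subset_Icc_self hs)]
    · filter_upwards [compl_mem_ae_iff.2 (measure_singleton (μ := volume) t)] with s hne hs
      rw [uIoc_of_le ht.1.le] at hs
      have hst : s < t := lt_of_le_of_ne hs.2 hne
      have hsT : s ∈ Ioc 0 T := ⟨hs.1, hs.2.trans ht.2⟩
      rw [norm_mul, Real.norm_eq_abs, Real.norm_eq_abs, abs_of_nonneg (H.f_nonneg hsT), ← mul_assoc]
      exact mul_le_mul_of_nonneg_right (kern_bound hst (by linarith [et_pos n])
        (hL s (Ioc_subset_Icc_self hsT) t (Ioc_subset_Icc_self ht)) hL0) (H.f_nonneg hsT)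
    · rw [intervalIntegrable_iff_integrableOn_Ioc_of_le ht.1.le]
      exact (H.sing_int hT ht).const_mul L
    · filter_upwards [compl_mem_ae_iff.2 (measure_singleton (μ := volume) t)] with s hne hs
      rw [uIoc_of_le ht.1.le] at hs
      have hst : 0 < t - s := sub_pos.2 (lt_of_le_of_ne hs.2 hne)
      refine Tendsto.mul_const _ ?_
      have hc : Continuous (fun u : ℝ => hkx (t + |u| - s) (y s - y t)) :=
        hkx_cont (by fun_prop) (by fun_prop) fun u => by linarith [abs_nonneg u]
      have := (hc.tendsto 0).comp et_tendsto
      simp only [abs_zero, add_zero] at this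
      refine this.congr fun n => ?_
      simp only [Function.comp, abs_of_pos (et_pos n)]
  refine tendsto_nhds_unique (H.f_limit ht) (((l1.const_mul 2).add l2).congr fun n => ?_)
  rw [H.repr_eta hT ht (et_pos n) (y t)]
  ring

end IsFBPSol

lemma sqrt_inv_lint {a b s : ℝ} (hab : a ≤ b) :
    ∫⁻ t in Ioc a b, ENNReal.ofReal ((√(t - s))⁻¹) ≤ ENNReal.ofReal (2 * √(b - a)) := by
  set c := max a s
  rcases le_or_gt b c with hbc | hbc
  · have : ∫⁻ t in Ioc a b, ENNReal.ofReal ((√(t - s))⁻¹) = 0 := by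
      rw [setLIntegral_congr_fun (g := fun _ => 0) measurableSet_Ioc ?_]
      · simp
      intro t ht
      rcases le_max_iff.1 hbc with h | h
      · exact absurd (ht.1.trans_le ht.2) (not_lt.2 h)
      · simp [Real.sqrt_eq_zero_of_nonpos (show t - s ≤ 0 by linarith [ht.2])]
    rw [this]; exact zero_le
  have hsc : s ≤ c := le_max_right _ _
  have hac : a ≤ c := le_max_left _ _
  have h1 : ∫⁻ t in Ioc a b, ENNReal.ofReal ((√(t - s))⁻¹) = ∫⁻ t in Ioc c b, ENNReal.ofReal ((√(t - s))⁻¹) := by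
    rw [← Ioc_union_Ioc_eq_Ioc hac hbc.le, lintegral_union measurableSet_Ioc (by
      rw [Set.disjoint_left]; intro x hx hx'; exact absurd hx.2 (not_le.2 hx'.1))]
    have : ∫⁻ t in Ioc a c, ENNReal.ofReal ((√(t - s))⁻¹) = 0 := by
      rw [setLIntegral_congr_fun (g := fun _ => 0) measurableSet_Ioc ?_]
      · simp
      intro t ht
      have : t ≤ s := by
        rcases le_max_iff.1 ht.2 with h | h
        · exact absurd ht.1 (not_lt.2 h)
        · exact h
      simp [Real.sqrt_eq_zero_of_nonpos (show t - s ≤ 0 by linarith)]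
    rw [this, zero_add]
  rw [h1]
  have hd : ∀ t ∈ Ioo c b, HasDerivAt (fun t => 2 * √(t - s)) ((√(t - s))⁻¹) t := by
    intro t ht
    have h0 : 0 < t - s := by linarith [ht.1]
    have := (((hasDerivAt_id t).sub_const s).sqrt h0.ne').const_mul 2
    refine this.congr_deriv ?_
    have : √(t - s) ≠ 0 := by positivity
    simp only [id]
    field_simp
  have hcont : ContinuousOn (fun t => 2 * √(t - s)) (Icc c b) := by fun_prop
  have hint := intervalIntegral.integrableOn_deriv_of_nonneg hcont hd (fun t ht => by positivity)
  have hI := intervalIntegral.integral_eq_sub_of_hasDerivAt_of_le hbc.le hcont hd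
    ((intervalIntegrable_iff_integrableOn_Ioc_of_le hbc.le).2 hint)
  rw [← ofReal_integral_eq_lintegral_ofReal hint (Eventually.of_forall fun t => by positivity),
    ← intervalIntegral.integral_of_le hbc.le, hI]
  apply ENNReal.ofReal_le_ofReal
  have h2 : √(b - s) ≤ √(b - c) + √(c - s) := by
    have g1 := Real.sq_sqrt (show 0 ≤ b - c by linarith)
    have g2 := Real.sq_sqrt (show 0 ≤ c - s by linarith)
    have g3 := mul_nonneg (Real.sqrt_nonneg (b - c)) (Real.sqrt_nonneg (c - s))
    refine Real.sqrt_le_iff.2 ⟨by positivity, ?_⟩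
    nlinarith
  have h3 : √(b - c) ≤ √(b - a) := Real.sqrt_le_sqrt (by linarith)
  linarith

lemma volterra_lint {a b : ℝ} (hab : a ≤ b) {G : ℝ → ENNReal} (hG : AEMeasurable G (volume.restrict (Ioc 0 b))) :
    ∫⁻ t in Ioc a b, ∫⁻ s in Ioc 0 b, ENNReal.ofReal ((√(t - s))⁻¹) * G s
      ≤ ENNReal.ofReal (2 * √(b - a)) * ∫⁻ s in Ioc 0 b, G s := by
  rw [lintegral_lintegral_swap]
  · rw [← lintegral_const_mul'' _ hG]
    apply lintegral_mono
    intro s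
    simp only
    rw [lintegral_mul_const _ (by fun_prop)]
    gcongr
    exact sqrt_inv_lint hab
  · refine AEMeasurable.mul ?_ ?_
    · exact Measurable.aemeasurable (by fun_prop)
    · exact hG.comp_snd

namespace IsFBPSol
variable {K v T : ℝ} {π₀ : Measure ℝ} {p pt px pxx p₂ pt₂ px₂ pxx₂ : ℝ → ℝ → ℝ} {y y' y'' y₂ y₂' y₂'' : ℝ → ℝ}

lemma y_diff (H : IsFBPSol K v T π₀ p pt px pxx y y' y'') (H₂ : IsFBPSol K v T π₀ p₂ pt₂ px₂ pxx₂ y₂ y₂' y₂'')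
    (hK : 0 ≤ K) (hT : 0 < T) {b : ℝ} (hb : b ∈ Ioc 0 T) {s t : ℝ} (hs : s ∈ Icc 0 b) (ht : t ∈ Icc 0 b) :
    |(y s - y t) - (y₂ s - y₂ t)| ≤ K / 2 * (∫ r in Ioc 0 b, |p r (y r) - p₂ r (y₂ r)|) * |s - t| := by
  have hsub : Icc 0 b ⊆ Icc 0 T := Icc_subset_Icc le_rfl hb.2
  have hfi : IntegrableOn (fun r => |p r (y r) - p₂ r (y₂ r)|) (Ioc 0 T) := ((H.f_int hT).sub (H₂.f_int hT)).abs
  have key : ∀ r ∈ Icc 0 b, |y' r - y₂' r| ≤ K / 2 * (∫ r in Ioc 0 b, |p r (y r) - p₂ r (y₂ r)|) := by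
    intro r hr
    have h1 : ∫ q in (0:ℝ)..r, (y'' q - y₂'' q) = (y' r - y₂' r) - (y' 0 - y₂' 0) := by
      have hs0 : Icc 0 r ⊆ Icc 0 T := Icc_subset_Icc le_rfl (hr.2.trans hb.2)
      refine intervalIntegral.integral_eq_sub_of_hasDerivAt_of_le (f := fun q => y' q - y₂' q) hr.1 ?_ ?_ ?_
      · exact (H.y'_cont.sub H₂.y'_cont).mono hs0
      · intro q hq
        have hq' : q ∈ Icc 0 T := hs0 (Ioo_subset_Icc_self hq)
        exact ((H.y'_deriv q hq').sub (H₂.y'_deriv q hq')).hasDerivAt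
          (Icc_mem_nhds hq.1 (hq.2.trans_le (hr.2.trans hb.2)))
      · exact ((H.y''_cont.sub H₂.y''_cont).mono hs0).intervalIntegrable_of_Icc hr.1
    rw [H.y'_init, H₂.y'_init, sub_self, sub_zero] at h1
    rw [← h1, intervalIntegral.integral_of_le hr.1]
    rw [← Real.norm_eq_abs]
    refine (norm_integral_le_integral_norm _).trans ?_
    rw [← integral_const_mul]
    calc ∫ q in Ioc 0 r, ‖y'' q - y₂'' q‖ = ∫ q in Ioc 0 r, K / 2 * |p q (y q) - p₂ q (y₂ q)| := by
          refine setIntegral_congr_fun measurableSet_Ioc fun q hq => ?_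
          have hq' : q ∈ Ioc 0 T := ⟨hq.1, hq.2.trans (hr.2.trans hb.2)⟩
          rw [H.accel q hq', H₂.accel q hq', ← mul_sub, Real.norm_eq_abs, abs_mul, abs_neg,
            abs_of_nonneg (by positivity : 0 ≤ K / 2)]
      _ ≤ _ := by
          refine setIntegral_mono_set ((hfi.mono_set (Ioc_subset_Ioc le_rfl hb.2)).const_mul _) ?_ ?_
          · exact Eventually.of_forall fun q => by positivity
          · exact (Ioc_subset_Ioc le_rfl hr.2).eventuallyLE
  have := Convex.norm_image_sub_le_of_norm_hasDerivWithin_le (f := fun r => y r - y₂ r) (f' := fun r => y' r - y₂' r)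
    (s := Icc 0 b) (x := t) (y := s) (fun r hr => ((H.y_deriv r (hsub hr)).sub (H₂.y_deriv r (hsub hr))).mono hsub)
    key (convex_Icc 0 b) ht hs
  refine le_of_eq_of_le ?_ this
  rw [Real.norm_eq_abs]; congr 1; ring

lemma f_diff (H : IsFBPSol K v T π₀ p pt px pxx y y' y'') (H₂ : IsFBPSol K v T π₀ p₂ pt₂ px₂ pxx₂ y₂ y₂' y₂'')
    [IsProbabilityMeasure π₀]
    (hK : 0 ≤ K) (hT : 0 < T) {L : ℝ} (hL0 : 0 ≤ L) (hL : ∀ s ∈ Icc 0 T, ∀ t ∈ Icc 0 T, |y₂ s - y₂ t| ≤ L * |s - t|)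
    {b : ℝ} (hb : b ∈ Ioc 0 T) {t M : ℝ} (ht : t ∈ Ioc 0 b)
    (hM : M = (∫ r in Ioc 0 b, |p r (y r) - p₂ r (y₂ r)|)) :
    IntegrableOn (fun s => (√(t - s))⁻¹ * (L * |p s (y s) - p₂ s (y₂ s)| + 3 / 2 * K * M * p s (y s))) (Ioc 0 t) ∧
    |p t (y t) - p₂ t (y₂ t)| ≤ K * M +
      ∫ s in Ioc 0 t, (√(t - s))⁻¹ * (L * |p s (y s) - p₂ s (y₂ s)| + 3 / 2 * K * M * p s (y s)) := by
  have htT : t ∈ Ioc 0 T := ⟨ht.1, ht.2.trans hb.2⟩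
  have hM0 : 0 ≤ M := by rw [hM]; positivity
  have hyd := fun s t hs ht => H.y_diff H₂ hK hT hb (s := s) (t := t) hs ht
  rw [← hM] at hyd
  have i1 := H.sing_int hT htT
  have i2 := H₂.sing_int hT htT
  have hI : IntegrableOn (fun s => (√(t - s))⁻¹ * (L * |p s (y s) - p₂ s (y₂ s)| + 3 / 2 * K * M * p s (y s))) (Ioc 0 t) := by
    have := ((i1.sub i2).abs.const_mul L).add (i1.const_mul (3 / 2 * K * M))
    refine this.congr (Eventually.of_forall fun s => ?_)
    have h0 : 0 ≤ (√(t - s))⁻¹ := by positivity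
    simp only [Pi.add_apply, Pi.sub_apply]
    rw [← mul_sub, abs_mul, abs_of_nonneg h0]
    ring
  refine ⟨hI, ?_⟩
  -- pointwise kernel estimate
  have hker : ∀ s ∈ Ioo 0 t, |hkx (t - s) (y s - y t) * p s (y s) - hkx (t - s) (y₂ s - y₂ t) * p₂ s (y₂ s)|
      ≤ (√(t - s))⁻¹ * (L * |p s (y s) - p₂ s (y₂ s)| + 3 / 2 * K * M * p s (y s)) := by
    intro s hs
    have hsT : s ∈ Ioc 0 T := ⟨hs.1, hs.2.le.trans htT.2⟩
    have hts : 0 < t - s := by linarith [hs.2]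
    have hq : 0 < √(t - s) := by positivity
    have k1 : |hkx (t - s) (y₂ s - y₂ t)| ≤ L * (√(t - s))⁻¹ :=
      kern_bound hs.2 le_rfl (hL s (Ioc_subset_Icc_self hsT) t (Ioc_subset_Icc_self htT)) hL0
    have k2 : |hkx (t - s) (y s - y t) - hkx (t - s) (y₂ s - y₂ t)| ≤ 3 / 2 * K * M * (√(t - s))⁻¹ := by
      refine (hkx_lip hts _ _).trans ?_
      have := hyd s t ⟨hs.1.le, hs.2.le.trans ht.2⟩ (Ioc_subset_Icc_self ht)
      calc _ ≤ 3 / ((t - s) * √(t - s)) * (K / 2 * M * |s - t|) := by gcongr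
        _ = _ := by
          rw [abs_sub_comm, abs_of_pos hts]; field_simp
    have e : hkx (t - s) (y s - y t) * p s (y s) - hkx (t - s) (y₂ s - y₂ t) * p₂ s (y₂ s)
      = hkx (t - s) (y₂ s - y₂ t) * (p s (y s) - p₂ s (y₂ s))
        + (hkx (t - s) (y s - y t) - hkx (t - s) (y₂ s - y₂ t)) * p s (y s) := by ring
    rw [e]
    refine (abs_add_le _ _).trans ?_
    rw [abs_mul, abs_mul, abs_of_nonneg (H.p_nonneg s hsT (y s))]
    have := H.p_nonneg s hsT (y s)
    calc _ ≤ L * (√(t - s))⁻¹ * |p s (y s) - p₂ s (y₂ s)| + 3 / 2 * K * M * (√(t - s))⁻¹ * p s (y s) := by gcongr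
      _ = _ := by ring
  have hkint : ∀ {q qt qx qxx : ℝ → ℝ → ℝ} {z z' z'' : ℝ → ℝ}, IsFBPSol K v T π₀ q qt qx qxx z z' z'' →
      IntegrableOn (fun s => hkx (t - s) (z s - z t) * q s (z s)) (Ioc 0 t) := by
    intro q qt qx qxx z z' z'' Hq
    obtain ⟨L', hL0', -, hL'⟩ := Hq.y_bdd
    have i := (Hq.sing_int hT htT).const_mul L'
    have i : IntegrableOn (fun s => L' * ((√(t - s))⁻¹ * q s (z s))) (Ioc 0 t) := i
    rw [integrableOn_Ioc_iff_integrableOn_Ioo] at i ⊢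
    refine Integrable.mono i ?_ ?_
    · refine ContinuousOn.aestronglyMeasurable ?_ measurableSet_Ioo
      have hz : ContinuousOn z (Ioo 0 t) := Hq.y_cont.mono fun s hs => ⟨hs.1.le, hs.2.le.trans htT.2⟩
      refine ContinuousOn.mul ?_ (Hq.f_cont.mono fun s hs => ⟨hs.1, hs.2.le.trans htT.2⟩)
      rw [continuousOn_iff_continuous_restrict] at hz ⊢
      exact hkx_cont (A := fun s : Ioo 0 t => t - s.1) (X := fun s : Ioo 0 t => z s.1 - z t) (by fun_prop)
        (hz.sub continuous_const) fun s => by linarith [s.2.2]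
    · refine (ae_restrict_iff' measurableSet_Ioo).2 (Eventually.of_forall fun s hs => ?_)
      have hsT : s ∈ Ioc 0 T := ⟨hs.1, hs.2.le.trans htT.2⟩
      have k1 : |hkx (t - s) (z s - z t)| ≤ L' * (√(t - s))⁻¹ :=
        kern_bound hs.2 le_rfl (hL' s (Ioc_subset_Icc_self hsT) t (Ioc_subset_Icc_self htT)) hL0'
      rw [norm_mul, ← mul_assoc, norm_mul]
      gcongr
      exact k1.trans (le_abs_self _)
  have e := H.repr_f hT htT
  have e₂ := H₂.repr_f hT htT
  rw [intervalIntegral.integral_of_le ht.1.le] at e e₂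
  have hA : |∫ s in Ioc 0 t, (hkx (t - s) (y s - y t) * p s (y s) - hkx (t - s) (y₂ s - y₂ t) * p₂ s (y₂ s))|
      ≤ ∫ s in Ioc 0 t, (√(t - s))⁻¹ * (L * |p s (y s) - p₂ s (y₂ s)| + 3 / 2 * K * M * p s (y s)) := by
    rw [← Real.norm_eq_abs]
    refine norm_integral_le_of_norm_le hI ?_
    rw [← Measure.restrict_congr_set (Ioo_ae_eq_Ioc (μ := volume) (a := (0:ℝ)) (b := t))]
    exact (ae_restrict_iff' measurableSet_Ioo).2 (Eventually.of_forall hker)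
  rw [integral_sub (hkint H) (hkint H₂)] at hA
  have hkI : ∀ c : ℝ, Integrable (fun x => hk t (x - c)) π₀ := fun c => by
    refine Integrable.of_bound (C := (√t)⁻¹) ?_ (Eventually.of_forall fun x => ?_)
    · exact (hk_cont (A := fun _ : ℝ => t) (X := fun x : ℝ => x - c) continuous_const (by fun_prop) fun _ => ht.1).aestronglyMeasurable
    · rw [Real.norm_eq_abs, abs_of_pos (hk_pos ht.1 _)]
      exact hk_le ht.1 _
  have hB : |(∫ x, hk t (x - y t) ∂π₀) - ∫ x, hk t (x - y₂ t) ∂π₀| ≤ K / 2 * M := by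
    rw [← integral_sub (hkI _) (hkI _)]
    have : ∀ x, ‖hk t (x - y t) - hk t (x - y₂ t)‖ ≤ K / 2 * M := by
      intro x
      refine (hk_lip ht.1 _ _).trans ?_
      have h0 := hyd t 0 (Ioc_subset_Icc_self ht) ⟨le_rfl, ht.1.le.trans ht.2⟩
      rw [H.y_init, H₂.y_init, sub_zero, sub_zero, sub_zero, abs_of_pos ht.1] at h0
      rw [show x - y t - (x - y₂ t) = -(y t - y₂ t) by ring, abs_neg]
      have ht0 := ht.1
      calc _ ≤ 1 / t * (K / 2 * M * t) := by gcongr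
        _ = _ := by field_simp
    have := norm_integral_le_of_norm_le_const (μ := π₀) (Eventually.of_forall this)
    simpa using this
  rw [e, e₂]
  have hA' := abs_le.1 hA
  have hB' := abs_le.1 hB
  rw [abs_le]
  constructor <;> linarith [hA'.1, hA'.2, hB'.1, hB'.2]

lemma f_step (H : IsFBPSol K v T π₀ p pt px pxx y y' y'') (H₂ : IsFBPSol K v T π₀ p₂ pt₂ px₂ pxx₂ y₂ y₂' y₂'')
    [IsProbabilityMeasure π₀]
    (hK : 0 ≤ K) (hT : 0 < T) {L : ℝ} (hL0 : 0 ≤ L) (hL : ∀ s ∈ Icc 0 T, ∀ t ∈ Icc 0 T, |y₂ s - y₂ t| ≤ L * |s - t|)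
    {a b h : ℝ} (ha : 0 ≤ a) (hab : a < b) (hbT : b ≤ T) (hbh : b ≤ a + h)
    (hh : K * h + 2 * √h * (L + 3 / 2 * K * ∫ s in Ioc 0 T, p s (y s)) < 1)
    (heq : ∀ t ∈ Ioc 0 a, p t (y t) = p₂ t (y₂ t)) : ∀ t ∈ Ioc 0 b, p t (y t) = p₂ t (y₂ t) := by
  have hb : b ∈ Ioc 0 T := ⟨ha.trans_lt hab, hbT⟩
  have hsub : Ioc 0 b ⊆ Ioc 0 T := Ioc_subset_Ioc le_rfl hbT
  have hsub' : Ioc a b ⊆ Ioc 0 b := Ioc_subset_Ioc ha le_rfl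
  set δ : ℝ → ℝ := fun r => |p r (y r) - p₂ r (y₂ r)| with hδ
  set F := ∫ s in Ioc 0 T, p s (y s) with hF
  have i1 := (H.f_int hT)
  have iδT : IntegrableOn δ (Ioc 0 T) := ((H.f_int hT).sub (H₂.f_int hT)).abs
  have iδ : IntegrableOn δ (Ioc 0 b) := iδT.mono_set hsub
  obtain ⟨M, hM⟩ : ∃ M, M = ∫ r in Ioc 0 b, δ r := ⟨_, rfl⟩
  have hM0 : 0 ≤ M := by rw [hM]; positivity
  have hMab : M = ∫ r in Ioc a b, δ r := by
    rw [hM]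
    refine setIntegral_eq_of_subset_of_forall_sdiff_eq_zero measurableSet_Ioc hsub' fun t ht => ?_
    have : t ∈ Ioc 0 a := ⟨ht.1.1, not_lt.1 fun h => ht.2 ⟨h, ht.1.2⟩⟩
    simp [hδ, heq t this]
  set G : ℝ → ℝ := fun s => L * δ s + 3 / 2 * K * M * p s (y s) with hG
  have hG0 : ∀ s ∈ Ioc 0 b, 0 ≤ G s := fun s hs => by
    have := H.p_nonneg s (hsub hs) (y s)
    simp only [hG, hδ]; positivity
  have iG : IntegrableOn G (Ioc 0 b) := (iδ.const_mul L).add ((i1.mono_set hsub).const_mul _)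
  have hpt : ∀ t ∈ Ioc a b, ENNReal.ofReal (δ t) ≤ ENNReal.ofReal (K * M) +
      ∫⁻ s in Ioc 0 b, ENNReal.ofReal ((√(t - s))⁻¹) * ENNReal.ofReal (G s) := by
    intro t ht
    have ht' := hsub' ht
    obtain ⟨hI, hle⟩ := H.f_diff H₂ hK hT hL0 hL hb ht' hM
    refine (ENNReal.ofReal_le_ofReal hle).trans ?_
    refine ENNReal.ofReal_add_le.trans ?_
    gcongr
    rw [ofReal_integral_eq_lintegral_ofReal hI]
    · refine (lintegral_mono_set (Ioc_subset_Ioc le_rfl ht.2)).trans (lintegral_mono fun s => ?_)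
      rw [ENNReal.ofReal_mul (by positivity)]
    · refine (ae_restrict_iff' measurableSet_Ioc).2 (Eventually.of_forall fun s hs => ?_)
      exact mul_nonneg (by positivity) (hG0 s ⟨hs.1, hs.2.trans ht.2⟩)
  have hGint : ∫ s in Ioc 0 b, G s ≤ (L + 3 / 2 * K * F) * M := by
    have : ∫ s in Ioc 0 b, G s = L * M + 3 / 2 * K * M * ∫ s in Ioc 0 b, p s (y s) := by
      simp only [hG]
      rw [integral_add (iδ.const_mul L) ((i1.mono_set hsub).const_mul _), integral_const_mul, integral_const_mul, hM]
    have h2 : ∫ s in Ioc 0 b, p s (y s) ≤ F := by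
      refine setIntegral_mono_set i1 ?_ hsub.eventuallyLE
      exact (ae_restrict_iff' measurableSet_Ioc).2 (Eventually.of_forall fun s hs => H.p_nonneg s hs (y s))
    rw [this]
    have : 3 / 2 * K * M * ∫ s in Ioc 0 b, p s (y s) ≤ 3 / 2 * K * M * F := by gcongr
    linarith
  have hGint0 : 0 ≤ ∫ s in Ioc 0 b, G s := setIntegral_nonneg measurableSet_Ioc hG0
  have hfin : ENNReal.ofReal M ≤ ENNReal.ofReal (K * M * (b - a) + 2 * √(b - a) * ∫ s in Ioc 0 b, G s) := by
    have e1 : ENNReal.ofReal M = ∫⁻ t in Ioc a b, ENNReal.ofReal (δ t) := by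
      rw [hMab]
      exact ofReal_integral_eq_lintegral_ofReal (iδ.mono_set hsub') (Eventually.of_forall fun t => abs_nonneg _)
    rw [e1]
    refine (setLIntegral_mono' measurableSet_Ioc hpt).trans ?_
    rw [lintegral_add_left (by fun_prop)]
    refine (add_le_add_right (volterra_lint hab.le (iG.aemeasurable.ennreal_ofReal)) _).trans ?_
    have hba : 0 ≤ b - a := by linarith
    rw [ENNReal.ofReal_add (by positivity) (by positivity), ENNReal.ofReal_mul (p := K * M) (by positivity),
      ENNReal.ofReal_mul (p := 2 * √(b - a)) (by positivity)]
    refine add_le_add (le_of_eq ?_) (le_of_eq ?_)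
    · simp
    · rw [ofReal_integral_eq_lintegral_ofReal iG
        ((ae_restrict_iff' measurableSet_Ioc).2 (Eventually.of_forall hG0))]
  have hba : 0 ≤ b - a := by linarith
  have hMle : M ≤ K * M * (b - a) + 2 * √(b - a) * ∫ s in Ioc 0 b, G s :=
    (ENNReal.ofReal_le_ofReal_iff (by positivity)).1 hfin
  have hMz : M = 0 := by
    have h1 : √(b - a) ≤ √h := Real.sqrt_le_sqrt (by linarith)
    have h2 : K * M * (b - a) ≤ K * M * h := by gcongr; linarith
    have h3 : 2 * √(b - a) * ∫ s in Ioc 0 b, G s ≤ 2 * √h * ((L + 3 / 2 * K * F) * M) := by gcongr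
    by_contra hne
    have hpos : 0 < M := lt_of_le_of_ne hM0 (Ne.symm hne)
    nlinarith [mul_lt_mul_of_pos_right hh hpos]
  -- conclude by continuity
  have hδc : ContinuousOn δ (Ioc 0 b) := ((H.f_cont.sub H₂.f_cont).mono hsub).abs
  rw [hMz, eq_comm, setIntegral_eq_zero_iff_of_nonneg_ae (Eventually.of_forall fun t => abs_nonneg _) iδ] at hM
  have hz : EqOn δ 0 (Ioc 0 b) := by
    exact Measure.eqOn_Ioc_of_ae_eq volume hM hδc continuousOn_const
  intro t ht
  have := hz ht
  simp only [hδ, Pi.zero_apply, abs_eq_zero] at this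
  linarith

lemma f_eq (H : IsFBPSol K v T π₀ p pt px pxx y y' y'') (H₂ : IsFBPSol K v T π₀ p₂ pt₂ px₂ pxx₂ y₂ y₂' y₂'')
    [IsProbabilityMeasure π₀] (hK : 0 ≤ K) (hT : 0 < T) : ∀ t ∈ Ioc 0 T, p t (y t) = p₂ t (y₂ t) := by
  obtain ⟨L, hL0, -, hL⟩ := H₂.y_bdd
  obtain ⟨h, hh0, hh⟩ : ∃ h : ℝ, 0 < h ∧ K * h + 2 * √h * (L + 3 / 2 * K * ∫ s in Ioc 0 T, p s (y s)) < 1 := by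
    have hc : Continuous (fun h : ℝ => K * h + 2 * √h * (L + 3 / 2 * K * ∫ s in Ioc 0 T, p s (y s))) := by fun_prop
    have h1 : ∀ᶠ h in 𝓝[>] (0:ℝ), K * h + 2 * √h * (L + 3 / 2 * K * ∫ s in Ioc 0 T, p s (y s)) < 1 :=
      (hc.tendsto 0).mono_left nhdsWithin_le_nhds |>.eventually (gt_mem_nhds (by simp))
    obtain ⟨h, h2, h3⟩ := (h1.and self_mem_nhdsWithin).exists
    exact ⟨h, h3, h2⟩
  have hn : ∀ n : ℕ, ∀ t ∈ Ioc 0 (min (n * h) T), p t (y t) = p₂ t (y₂ t) := by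
    intro n
    induction n with
    | zero => 
      intro t ht
      have := ht.2.trans (min_le_left _ _)
      simp at this
      exact absurd ht.1 (not_lt.2 this)
    | succ n ih =>
      rcases le_or_gt T (n * h) with hc | hc
      · rw [min_eq_right hc] at ih
        intro t ht
        exact ih t ⟨ht.1, ht.2.trans (min_le_right _ _)⟩
      · rw [min_eq_left hc.le] at ih
        refine H.f_step H₂ hK hT hL0 hL (a := n * h) (h := h) (by positivity) ?_ (min_le_right _ _) ?_ hh ih
        · refine lt_min ?_ hc
          push_cast; linarith
        · refine (min_le_left _ _).trans ?_
          push_cast; linarith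
  obtain ⟨n, hnT⟩ := exists_nat_ge (T / h)
  have := hn n
  rwa [min_eq_right ((div_le_iff₀ hh0).1 hnT)] at this

lemma y_eq (H : IsFBPSol K v T π₀ p pt px pxx y y' y'') (H₂ : IsFBPSol K v T π₀ p₂ pt₂ px₂ pxx₂ y₂ y₂' y₂'')
    [IsProbabilityMeasure π₀] (hK : 0 ≤ K) (hT : 0 < T) : ∀ t ∈ Icc 0 T, y t = y₂ t := by
  intro t ht
  have h1 := H.y_diff H₂ hK hT ⟨hT, le_rfl⟩ ht ⟨le_rfl, hT.le⟩
  have h2 : ∫ r in Ioc 0 T, |p r (y r) - p₂ r (y₂ r)| = 0 := by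
    refine setIntegral_eq_zero_of_forall_eq_zero fun r hr => ?_
    rw [H.f_eq H₂ hK hT r hr, sub_self, abs_zero]
  rw [h2, H.y_init, H₂.y_init, mul_zero, zero_mul, sub_zero, sub_zero] at h1
  exact sub_eq_zero.1 (abs_eq_zero.1 (le_antisymm h1 (abs_nonneg _)))

lemma p_eq (H : IsFBPSol K v T π₀ p pt px pxx y y' y'') (H₂ : IsFBPSol K v T π₀ p₂ pt₂ px₂ pxx₂ y₂ y₂' y₂'')
    [IsProbabilityMeasure π₀] (hK : 0 ≤ K) (hT : 0 < T) : ∀ t ∈ Ioc 0 T, ∀ x, y t ≤ x → p t x = p₂ t x := by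
  intro t ht z hz
  have hy := H.y_eq H₂ hK hT
  have hf := H.f_eq H₂ hK hT
  have hyt := hy t (Ioc_subset_Icc_self ht)
  rcases hz.eq_or_lt with rfl | hz
  · have := hf t ht
    rwa [← hyt] at this
  have hpc : ∀ {q qt qx qxx : ℝ → ℝ → ℝ} {w w' w'' : ℝ → ℝ}, IsFBPSol K v T π₀ q qt qx qxx w w' w'' → w t < z →
      ContinuousAt (q t) z := by
    intro q qt qx qxx w w' w'' Hq hw
    have := (Hq.p_x t ht z hw.le).continuousWithinAt
    exact this.continuousAt (Ici_mem_nhds hw)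
  have l1 := hk_peak (H.p_int ht) (hpc H hz)
  have l2 := hk_peak (H₂.p_int ht) (hpc H₂ (hyt ▸ hz))
  refine tendsto_nhds_unique l1 (l2.congr fun n => ?_)
  rw [H.repr_eta hT ht (et_pos n), H₂.repr_eta hT ht (et_pos n)]
  congr 2
  refine intervalIntegral.integral_congr_ae (Eventually.of_forall fun s hs => ?_)
  rw [uIoc_of_le ht.1.le] at hs
  have hs' : s ∈ Ioc 0 T := ⟨hs.1, hs.2.trans ht.2⟩
  rw [hf s hs', hy s (Ioc_subset_Icc_self hs')]

end IsFBPSol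

end Helpers

/-- Uniqueness of the classical solution to the free boundary problem: any two classical
solutions with the same impulse constant `K ≥ 0`, initial velocity `v` and initial heat
distribution `π₀` (a probability measure supported in `[0,∞)`) have identical barriers
and identical densities on their common domain. -/
theorem stmt_18 (K v T : ℝ) (hK : 0 ≤ K) (hT : 0 < T)
    (π₀ : Measure ℝ) (hprob : IsProbabilityMeasure π₀)
    (hsupp : π₀ (Set.Iio 0) = 0)
    (p₁ pt₁ px₁ pxx₁ p₂ pt₂ px₂ pxx₂ : ℝ → ℝ → ℝ)
    (y₁ y₁' y₁'' y₂ y₂' y₂'' : ℝ → ℝ)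
    (h₁ : IsFBPSol K v T π₀ p₁ pt₁ px₁ pxx₁ y₁ y₁' y₁'')
    (h₂ : IsFBPSol K v T π₀ p₂ pt₂ px₂ pxx₂ y₂ y₂' y₂'') :
    (∀ t ∈ Set.Icc 0 T, y₁ t = y₂ t) ∧
    (∀ t ∈ Set.Ioc 0 T, ∀ x, y₁ t ≤ x → p₁ t x = p₂ t x) := by
  exact ⟨h₁.y_eq h₂ hK hT, h₁.p_eq h₂ hK hT⟩
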